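/- Let Λ be a compact set in the space of holomorphic maps h : ℂ̂ → ℂ̂ of degree at least two, endowed with the topology of uniform convergence on ℂ̂, and let G be the rational semigroup generated by Λ. Then there exists a positive constant C such that for every subsemigroup H of G the Julia set J(H) is C-uniformly perfect. Furthermore, for any subsemigroup H of G, if a point z₀ ∈ J(H) is such that there exists h ∈ H with h(z₀) = z₀ and h′(z₀) = 0, then z₀ belongs to the interior of J(H). -/

import Mathlib

open Set Metric Topology Filter MeasureTheory

noncomputable section

/-- The Riemann sphere `ℂ̂`, as a type synonym of the one-point compactification
`Option ℂ = OnePoint ℂ` of `ℂ`, equipped below with the spherical metric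
(induced by a stereographic-type embedding into `ℂ × ℝ`). -/
def CSphere : Type := Option ℂ

namespace CSphere

/-- The point at infinity of the Riemann sphere. -/
def infty : CSphere := (none : Option ℂ)

/-- The inclusion of `ℂ` into the Riemann sphere. -/
def ofC (z : ℂ) : CSphere := (some z : Option ℂ)

/-- A stereographic-type embedding of the Riemann sphere into `ℂ × ℝ`,
used to induce the spherical metric. -/
def embed (z : CSphere) : ℂ × ℝ :=
  Option.rec ((0 : ℂ), (1 : ℝ))
    (fun w => ((2 / (1 + ‖w‖ ^ 2)) • w, (‖w‖ ^ 2 - 1) / (‖w‖ ^ 2 + 1))) z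

@[simp] lemma embed_infty : embed infty = ((0 : ℂ), (1 : ℝ)) := rfl

@[simp] lemma embed_ofC (w : ℂ) :
    embed (ofC w) = (((2 / (1 + ‖w‖ ^ 2)) • w : ℂ), (‖w‖ ^ 2 - 1) / (‖w‖ ^ 2 + 1)) := rfl

lemma cases' (z : CSphere) : z = infty ∨ ∃ w : ℂ, z = ofC w :=
  Option.rec (Or.inl rfl) (fun w => Or.inr ⟨w, rfl⟩) z

lemma embed_inj : Function.Injective embed := by
  intro a b h
  rcases cases' a with rfl | ⟨v, rfl⟩ <;> rcases cases' b with rfl | ⟨w, rfl⟩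
  · rfl
  · exfalso
    have h2 := congrArg Prod.snd h
    simp only [embed_infty, embed_ofC] at h2
    have hw : (0:ℝ) < ‖w‖ ^ 2 + 1 := by positivity
    rw [eq_div_iff (by nlinarith : (‖w‖ ^ 2 + 1 : ℝ) ≠ 0)] at h2
    nlinarith
  · exfalso
    have h2 := congrArg Prod.snd h
    simp only [embed_infty, embed_ofC] at h2
    have hv : (0:ℝ) < ‖v‖ ^ 2 + 1 := by positivity
    rw [div_eq_iff (by nlinarith : (‖v‖ ^ 2 + 1 : ℝ) ≠ 0)] at h2
    nlinarith
  · have h2 := congrArg Prod.snd h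
    simp only [embed_ofC] at h2
    have hv : (0:ℝ) < ‖v‖ ^ 2 + 1 := by positivity
    have hw : (0:ℝ) < ‖w‖ ^ 2 + 1 := by positivity
    have hnorm : ‖v‖ ^ 2 = ‖w‖ ^ 2 := by
      rw [div_eq_div_iff (by nlinarith : (‖v‖ ^ 2 + 1 : ℝ) ≠ 0)
        (by nlinarith : (‖w‖ ^ 2 + 1 : ℝ) ≠ 0)] at h2
      nlinarith
    have h1 := congrArg Prod.fst h
    simp only [embed_ofC, hnorm] at h1
    have hc : (2 / (1 + ‖w‖ ^ 2) : ℝ) ≠ 0 := by positivity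
    exact congrArg ofC (smul_right_injective ℂ hc h1)

/-- The spherical metric on the Riemann sphere. -/
instance : MetricSpace CSphere := MetricSpace.induced embed embed_inj inferInstance

instance : MeasurableSpace CSphere := borel CSphere

instance : BorelSpace CSphere := ⟨rfl⟩

/-- The self-map of the Riemann sphere induced by a pair of polynomials `p, q`,
i.e. the rational map `z ↦ p(z)/q(z)`. -/
def ratLift (p q : Polynomial ℂ) (z : CSphere) : CSphere :=
  Option.rec
    (if q.natDegree < p.natDegree then infty
     else if p.natDegree < q.natDegree then ofC 0
     else ofC (p.leadingCoeff / q.leadingCoeff))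
    (fun w => if q.eval w = 0 then infty else ofC (p.eval w / q.eval w)) z

/-- `φ` is the rational map on the Riemann sphere determined by the coprime
pair of polynomials `(p, q)` with `q ≠ 0`. -/
def IsRatPair (p q : Polynomial ℂ) (φ : CSphere → CSphere) : Prop :=
  q ≠ 0 ∧ IsCoprime p q ∧ φ = ratLift p q

/-- `φ` is a rational map of degree `n` on the Riemann sphere. -/
def ratDegEq (φ : CSphere → CSphere) (n : ℕ) : Prop :=
  ∃ p q : Polynomial ℂ, IsRatPair p q φ ∧ max p.natDegree q.natDegree = n

/-- `φ` is a rational map on the Riemann sphere (constants allowed). -/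
def IsRatMap (φ : CSphere → CSphere) : Prop := ∃ n, ratDegEq φ n

/-- `φ` is a Möbius transformation of the Riemann sphere. -/
def IsMobius (φ : CSphere → CSphere) : Prop := ratDegEq φ 1

/-- `φ` is a non-constant rational map on the Riemann sphere. -/
def IsNonconstRatMap (φ : CSphere → CSphere) : Prop := ∃ n, 1 ≤ n ∧ ratDegEq φ n

/-- `φ` is a rational map of degree at least two. -/
def IsRatMapDegGeTwo (φ : CSphere → CSphere) : Prop := ∃ n, 2 ≤ n ∧ ratDegEq φ n

end CSphere

/-- For a proper holomorphic map `g : V → B`, "`deg (g : V → B) ≤ N`":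
every point of `B` has at most `N` preimages in `V`.  (For proper holomorphic
maps this is equivalent to the degree, counted with multiplicity, being `≤ N`,
since a generic point has `deg` distinct preimages.) -/
def degLe {α β : Type*} (gmap : α → β) (V : Set α) (B : Set β) (N : ℕ) : Prop :=
  ∀ w ∈ B, (V ∩ gmap ⁻¹' {w}).ncard ≤ N

/-- `K` is `C`-uniformly perfect: `K` has at least two points, and every round
annulus `{z | r < dist a z < R}` disjoint from `K` which separates `K`
has modulus `log (R/r) / (2π) < C`.  (By Teichmüller's theorem this round-annulus
formulation is equivalent to the formulation with arbitrary separating ring domains.) -/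
def UnifPerfect {α : Type*} [MetricSpace α] (K : Set α) (C : ℝ) : Prop :=
  K.Nontrivial ∧ ∀ (a : α) (r R : ℝ), 0 < r → r < R →
    (∀ z ∈ K, dist a z ≤ r ∨ R ≤ dist a z) →
    (K ∩ {z | dist a z ≤ r}).Nonempty →
    (K ∩ {z | R ≤ dist a z}).Nonempty →
    Real.log (R / r) < 2 * Real.pi * C

/-- `J` is `k`-porous: every ball `B(x,r)` centred on `J` contains a ball of
radius `k r` disjoint from `J`. -/
def kPorous {α : Type*} [MetricSpace α] (J : Set α) (k : ℝ) : Prop :=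
  ∀ x ∈ J, ∀ r > (0:ℝ), ∃ y, Metric.ball y (k * r) ⊆ Metric.ball x r \ J

/-- `J` is `k`-porous inside the subspace `A`: for every `x ∈ J` and `r > 0`
there is a relative ball in `A` of radius `k r` inside `B(x,r) ∩ A` missing `J`. -/
def kPorousIn {α : Type*} [MetricSpace α] (A J : Set α) (k : ℝ) : Prop :=
  ∀ x ∈ J, ∀ r > (0:ℝ), ∃ y ∈ A, A ∩ Metric.ball y (k * r) ⊆ (A ∩ Metric.ball x r) \ J

/-- Minimal number of balls of radius `r` needed to cover `s`. -/
def coverNum {α : Type*} [MetricSpace α] (s : Set α) (r : ℝ) : ℕ∞ :=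
  sInf {n : ℕ∞ | ∃ t : Finset α, (t.card : ℕ∞) = n ∧ s ⊆ ⋃ y ∈ t, Metric.ball y r}

/-- The upper box (Minkowski) dimension of a (bounded) set. -/
def upperBoxDim {α : Type*} [MetricSpace α] (s : Set α) : ℝ :=
  Filter.limsup (fun r : ℝ => Real.log ((coverNum s r).toNat : ℝ) / Real.log (1 / r))
    (𝓝[>] (0:ℝ))

/-- The norm of the derivative of `φ` at `z` with respect to the metrics of the
source and target (for a holomorphic map between spheres with their spherical
metrics, this is the usual spherical derivative `‖φ′(z)‖`). -/
def sphDeriv {α β : Type*} [MetricSpace α] [MetricSpace β] (φ : α → β) (z : α) : ℝ :=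
  Filter.limsup (fun w => dist (φ w) (φ z) / dist w z) (𝓝[≠] z)

/-- The derivative of `φ` along `S` vanishes at `z` (i.e. `z` is a critical point
with `φ′(z) = 0`, expressed metrically). -/
def critPtOn {α β : Type*} [MetricSpace α] [MetricSpace β] (φ : α → β) (S : Set α)
    (z : α) : Prop :=
  Filter.Tendsto (fun w => dist (φ w) (φ z) / dist w z) (𝓝[S \ {z}] z) (𝓝 0)

end
noncomputable section

open Set Metric Topology Filter MeasureTheory
open scoped ENNReal NNReal

/-- `G` is a rational semigroup: a set of non-constant rational self-maps of the
Riemann sphere closed under composition. -/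
def RatSemigroup (G : Set (CSphere → CSphere)) : Prop :=
  (∀ a ∈ G, ∀ b ∈ G, a ∘ b ∈ G) ∧ ∀ a ∈ G, CSphere.IsNonconstRatMap a

/-- The semigroup (under composition) generated by a set `S` of self-maps. -/
def genSet (S : Set (CSphere → CSphere)) : Set (CSphere → CSphere) :=
  {gm | ∃ l : List (CSphere → CSphere), l ≠ [] ∧ (∀ a ∈ l, a ∈ S) ∧
    gm = l.foldr (· ∘ ·) id}

/-- The rational semigroup `⟨h₁, …, h_m⟩` generated by finitely many maps. -/
def genFin {m : ℕ} (h : Fin m → CSphere → CSphere) : Set (CSphere → CSphere) :=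
  genSet (Set.range h)

/-- `H` is a subsemigroup of `G`. -/
def IsSubsemigroupOf (H G : Set (CSphere → CSphere)) : Prop :=
  H.Nonempty ∧ H ⊆ G ∧ ∀ a ∈ H, ∀ b ∈ H, a ∘ b ∈ H

/-- The Fatou set `F(G)` of a rational semigroup: the set of points having a
neighbourhood on which the family `G` is (uniformly) equicontinuous —
equivalently (by the Arzelà–Ascoli theorem, since `ℂ̂` is compact), normal. -/
def rsFatou (G : Set (CSphere → CSphere)) : Set CSphere :=
  {z | ∃ r > (0:ℝ), ∀ ε > (0:ℝ), ∃ δ > (0:ℝ), ∀ gm ∈ G,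
    ∀ w₁ ∈ ball z r, ∀ w₂ ∈ ball z r, dist w₁ w₂ < δ → dist (gm w₁) (gm w₂) < ε}

/-- The Julia set `J(G) = ℂ̂ \ F(G)`. -/
def rsJulia (G : Set (CSphere → CSphere)) : Set CSphere := (rsFatou G)ᶜ

/-- The set of exceptional points `E(G)`: points whose backward orbit contains
at most two points. -/
def rsE (G : Set (CSphere → CSphere)) : Set CSphere :=
  {z | ∃ a b : CSphere, {w | ∃ gm ∈ G, gm w = z} ⊆ {a, b}}

/-- `SH_N(G)`: the set of semi-hyperbolic points of degree `N` for the rational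
semigroup `G`. -/
def rsSHN (G : Set (CSphere → CSphere)) (N : ℕ) : Set CSphere :=
  {z | ∃ δ > (0:ℝ), ∀ gm ∈ G, ∀ y ∈ gm ⁻¹' ball z δ,
    degLe gm (connectedComponentIn (gm ⁻¹' ball z δ) y) (ball z δ) N}

/-- `UH(G) = ℂ̂ \ ⋃_N SH_N(G)`. -/
def rsUH (G : Set (CSphere → CSphere)) : Set CSphere := (⋃ N : ℕ, rsSHN G N)ᶜ

/-- `G = ⟨h₁, …, h_m⟩` satisfies the (backward) open set condition with the
open set `U` with respect to the generator system `h`. -/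
def OpenSetCond {m : ℕ} (h : Fin m → CSphere → CSphere) (U : Set CSphere) : Prop :=
  U.Nonempty ∧ IsOpen U ∧ (∀ j, h j ⁻¹' U ⊆ U) ∧
    Pairwise fun i j => Disjoint (h i ⁻¹' U) (h j ⁻¹' U)

/-- `μ` is a `δ`-subconformal measure for `G`. -/
def Subconformal (G : Set (CSphere → CSphere)) (δ : ℝ)
    (μ : MeasureTheory.Measure CSphere) : Prop :=
  ∀ gm ∈ G, ∀ A : Set CSphere, MeasurableSet A →
    μ (gm '' A) ≤ ∫⁻ z in A, ENNReal.ofReal (sphDeriv gm z ^ δ) ∂μ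

/-- `s(G)`: the infimum of exponents `δ ≥ 0` admitting a `δ`-subconformal
probability measure for `G`. -/
def sExp (G : Set (CSphere → CSphere)) : ℝ :=
  sInf {δ : ℝ | 0 ≤ δ ∧ ∃ μ : MeasureTheory.Measure CSphere,
    MeasureTheory.IsProbabilityMeasure μ ∧ Subconformal G δ μ}

/-- The Poincaré series `S(s, x) = ∑_{g ∈ G} ∑_{g(y) = x} ‖g′(y)‖^{-s}`. -/
def Ssum (G : Set (CSphere → CSphere)) (s : ℝ) (x : CSphere) : ℝ≥0∞ :=
  ∑' gm : G, ∑' y : ((gm : CSphere → CSphere) ⁻¹' {x}),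
    ENNReal.ofReal (sphDeriv (gm : CSphere → CSphere) (y : CSphere) ^ (-s))

/-- `s₀(G) = inf_x S(x) = inf {s | ∃ x, S(s, x) < ∞}`. -/
def s0Exp (G : Set (CSphere → CSphere)) : ℝ :=
  sInf {s : ℝ | ∃ x : CSphere, Ssum G s x < ⊤}

/-- The conical Julia set `J_con(G)` of a rational semigroup. -/
def rsJcon (G : Set (CSphere → CSphere)) : Set CSphere :=
  {z | z ∈ rsJulia G ∧ ∃ (N : ℕ) (r : ℝ), 0 < r ∧ ∀ ε > (0:ℝ), ∃ gm ∈ G,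
    gm z ∈ rsJulia G ∧
    Metric.diam (connectedComponentIn (gm ⁻¹' ball (gm z) r) z) ≤ ε ∧
    SimplyConnectedSpace ↥(connectedComponentIn (gm ⁻¹' ball (gm z) r) z) ∧
    degLe gm (connectedComponentIn (gm ⁻¹' ball (gm z) r) z) (ball (gm z) r) N}

/-- The rational map `z ↦ 1/z` on the Riemann sphere. -/
def sphInv : CSphere → CSphere := CSphere.ratLift 1 Polynomial.X

/-- The (complex) derivative of `h` at a fixed point `z` equals `d`, computed in
the affine chart at `z` (the chart `w ↦ 1/w` if `z = ∞`). -/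
def derivFixEq (h : CSphere → CSphere) (z : CSphere) (d : ℂ) : Prop :=
  (∃ zc : ℂ, z = CSphere.ofC zc ∧ ∃ Floc : ℂ → ℂ,
      (∀ᶠ w in 𝓝 zc, CSphere.ofC (Floc w) = h (CSphere.ofC w)) ∧
      HasDerivAt Floc d zc) ∨
  (z = CSphere.infty ∧ ∃ Floc : ℂ → ℂ,
      (∀ᶠ w in 𝓝 (0:ℂ), CSphere.ofC (Floc w) = sphInv (h (sphInv (CSphere.ofC w)))) ∧
      HasDerivAt Floc d 0)

/-- `z` is a parabolic fixed point of `h`: `h(z) = z` and `h′(z)` is a root of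
unity. -/
def IsParabolicFixPt (h : CSphere → CSphere) (z : CSphere) : Prop :=
  h z = z ∧ ∃ d : ℂ, derivFixEq h z d ∧ ∃ n : ℕ, 0 < n ∧ d ^ n = 1

/-- `φ` is an elliptic Möbius transformation: a Möbius map with a fixed point
whose multiplier has modulus one and is different from `1`. -/
def IsEllipticMobius (φ : CSphere → CSphere) : Prop :=
  CSphere.IsMobius φ ∧ ∃ (z : CSphere) (d : ℂ), φ z = z ∧ derivFixEq φ z d ∧
    ‖d‖ = 1 ∧ d ≠ 1

end
open scoped UniformConvergence

noncomputable section UPJ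
open Set Metric Topology Filter MeasureTheory
open scoped UniformConvergence
namespace UPJ

/-- Projection from `ℂ²` to the sphere. -/
def pr (v : ℂ × ℂ) : CSphere :=
  if v.2 = 0 then CSphere.infty else CSphere.ofC (v.1 / v.2)

def nn (v : ℂ × ℂ) : ℝ := ‖v.1‖ ^ 2 + ‖v.2‖ ^ 2

def wg (v w : ℂ × ℂ) : ℂ := v.1 * w.2 - v.2 * w.1

def al (u w : ℂ × ℂ) : ℂ := w.1 * (starRingEnd ℂ) u.1 + w.2 * (starRingEnd ℂ) u.2

lemma nn_pos {v : ℂ × ℂ} (hv : v ≠ 0) : 0 < nn v := by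
  unfold nn
  by_contra h
  apply hv
  have h1 : ‖v.1‖ ^ 2 = 0 := by nlinarith [sq_nonneg ‖v.1‖, sq_nonneg ‖v.2‖]
  have h2 : ‖v.2‖ ^ 2 = 0 := by nlinarith [sq_nonneg ‖v.1‖, sq_nonneg ‖v.2‖]
  ext <;> simp_all

lemma nn_ge (v : ℂ × ℂ) : ‖v‖ ^ 2 ≤ nn v := by
  unfold nn
  rw [Prod.norm_def]
  rcases max_cases ‖v.1‖ ‖v.2‖ with h | h <;> rw [h.1] <;> nlinarith [sq_nonneg ‖v.1‖, sq_nonneg ‖v.2‖]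

lemma nn_le (v : ℂ × ℂ) : nn v ≤ 2 * ‖v‖ ^ 2 := by
  unfold nn
  have h1 := norm_fst_le v
  have h2 := norm_snd_le v
  nlinarith [norm_nonneg v.1, norm_nonneg v.2]

lemma al_wg (u w : ℂ × ℂ) : ‖al u w‖ ^ 2 + ‖wg u w‖ ^ 2 = nn u * nn w := by
  unfold al wg nn
  simp only [← Complex.normSq_eq_norm_sq, Complex.normSq_apply]
  simp
  ring

lemma wg_al (u v w : ℂ × ℂ) : (nn u : ℂ) * wg v w = al u v * wg u w - wg u v * al u w := by
  have : (nn u : ℂ) = u.1 * (starRingEnd ℂ) u.1 + u.2 * (starRingEnd ℂ) u.2 := by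
    unfold nn
    push_cast
    rw [Complex.mul_conj, Complex.mul_conj, Complex.normSq_eq_norm_sq, Complex.normSq_eq_norm_sq]
    push_cast; ring
  rw [this]; unfold al wg; ring

lemma embed_pr {v : ℂ × ℂ} (hv : v ≠ 0) : CSphere.embed (pr v) =
    (2 * v.1 * (starRingEnd ℂ) v.2 / (nn v : ℂ), (‖v.1‖ ^ 2 - ‖v.2‖ ^ 2) / nn v) := by
  have hp := nn_pos hv
  unfold pr
  split_ifs with h
  · have h1 : v.1 ≠ 0 := fun h1 => hv (Prod.ext h1 h)
    have h1' : ‖v.1‖ ≠ 0 := by simpa using h1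
    simp [h, nn, h1']
  · have h' : ‖v.2‖ ≠ 0 := by simpa using h
    rw [CSphere.embed_ofC]
    have hnn : (0:ℝ) < ‖v.1‖ ^ 2 + ‖v.2‖ ^ 2 := hp
    have e1 : (2 / (1 + ‖v.1 / v.2‖ ^ 2) : ℝ) = 2 * ‖v.2‖ ^ 2 / nn v := by
      rw [norm_div]; unfold nn; field_simp; ring
    ext1
    · simp only
      rw [e1, Complex.real_smul]
      have : (nn v : ℂ) ≠ 0 := by exact_mod_cast hp.ne'
      push_cast
      have h3 : (‖v.2‖ : ℂ) ^ 2 = v.2 * (starRingEnd ℂ) v.2 := by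
        rw [Complex.mul_conj, Complex.normSq_eq_norm_sq]; push_cast; ring
      rw [h3]; field_simp
    · simp only
      rw [norm_div]; unfold nn
      have : ‖v.1‖ ^ 2 / ‖v.2‖ ^ 2 + 1 ≠ 0 := by positivity
      rw [div_pow]
      field_simp

lemma dist_def' (a b : CSphere) : dist a b = dist (CSphere.embed a) (CSphere.embed b) := rfl

lemma chord {v w : ℂ × ℂ} (hv : v ≠ 0) (hw : w ≠ 0) :
    ‖(CSphere.embed (pr v)).1 - (CSphere.embed (pr w)).1‖ ^ 2 +
    ((CSphere.embed (pr v)).2 - (CSphere.embed (pr w)).2) ^ 2 = 4 * ‖wg v w‖ ^ 2 / (nn v * nn w) := by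
  have hp := nn_pos hv
  have hq := nn_pos hw
  rw [embed_pr hv, embed_pr hw]
  simp only
  have h1 : (nn v : ℂ) ≠ 0 := by exact_mod_cast hp.ne'
  have h2 : (nn w : ℂ) ≠ 0 := by exact_mod_cast hq.ne'
  have e : 2 * v.1 * (starRingEnd ℂ) v.2 / (nn v : ℂ) - 2 * w.1 * (starRingEnd ℂ) w.2 / (nn w : ℂ)
     = (2 * v.1 * (starRingEnd ℂ) v.2 * nn w - 2 * w.1 * (starRingEnd ℂ) w.2 * nn v) / ((nn v * nn w : ℝ) : ℂ) := by
    push_cast; field_simp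
  rw [e, norm_div, Complex.norm_real, div_pow, Real.norm_eq_abs, sq_abs]
  field_simp
  unfold nn wg
  simp only [← Complex.normSq_eq_norm_sq, Complex.normSq_apply]
  simp
  ring

lemma dist_sq_le {v w : ℂ × ℂ} (hv : v ≠ 0) (hw : w ≠ 0) :
    dist (pr v) (pr w) ^ 2 ≤ 4 * ‖wg v w‖ ^ 2 / (nn v * nn w) := by
  rw [← chord hv hw, dist_def', Prod.dist_eq, dist_eq_norm, Real.dist_eq]
  rcases max_cases ‖(CSphere.embed (pr v)).1 - (CSphere.embed (pr w)).1‖ |(CSphere.embed (pr v)).2 - (CSphere.embed (pr w)).2| with h | h <;> rw [h.1]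
  · nlinarith [sq_nonneg ((CSphere.embed (pr v)).2 - (CSphere.embed (pr w)).2)]
  · rw [sq_abs]; nlinarith [sq_nonneg ‖(CSphere.embed (pr v)).1 - (CSphere.embed (pr w)).1‖]

lemma dist_sq_ge {v w : ℂ × ℂ} (hv : v ≠ 0) (hw : w ≠ 0) :
    2 * ‖wg v w‖ ^ 2 / (nn v * nn w) ≤ dist (pr v) (pr w) ^ 2 := by
  have : 2 * ‖wg v w‖ ^ 2 / (nn v * nn w) = (4 * ‖wg v w‖ ^ 2 / (nn v * nn w)) / 2 := by ring
  rw [this, ← chord hv hw, dist_def', Prod.dist_eq, dist_eq_norm, Real.dist_eq]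
  set a := ‖(CSphere.embed (pr v)).1 - (CSphere.embed (pr w)).1‖
  set b := (CSphere.embed (pr v)).2 - (CSphere.embed (pr w)).2
  have ha : 0 ≤ a := norm_nonneg _
  rw [← sq_abs b]
  have hb : 0 ≤ |b| := abs_nonneg _
  rcases max_cases a |b| with h | h <;> rw [h.1] <;> nlinarith

lemma pr_surj (z : CSphere) : ∃ v : ℂ × ℂ, v ≠ 0 ∧ nn v = 1 ∧ pr v = z := by
  suffices h : ∃ v : ℂ × ℂ, v ≠ 0 ∧ pr v = z by
    obtain ⟨v, hv, rfl⟩ := h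
    have hp := nn_pos hv
    have hs : (Real.sqrt (nn v) : ℂ) ≠ 0 := by exact_mod_cast (Real.sqrt_pos.2 hp).ne'
    have key : nn (v.1 / Real.sqrt (nn v), v.2 / Real.sqrt (nn v)) = 1 := by
      have h0 : nn (v.1 / Real.sqrt (nn v), v.2 / Real.sqrt (nn v)) =
        ‖v.1 / Real.sqrt (nn v)‖ ^ 2 + ‖v.2 / Real.sqrt (nn v)‖ ^ 2 := rfl
      rw [h0]
      simp only [norm_div, Complex.norm_real, Real.norm_eq_abs, div_pow, sq_abs, Real.sq_sqrt hp.le]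
      rw [← add_div]; exact div_self hp.ne'
    refine ⟨(v.1 / Real.sqrt (nn v), v.2 / Real.sqrt (nn v)), ?_, key, ?_⟩
    · intro h0; rw [h0] at key; simp [nn] at key
    · unfold pr
      simp only [div_eq_zero_iff, hs, or_false]
      rw [div_div_div_cancel_right₀ hs]
  rcases CSphere.cases' z with rfl | ⟨w, rfl⟩
  · exact ⟨(1, 0), by simp, by simp [pr]⟩
  · exact ⟨(w, 1), by simp, by simp [pr]⟩

lemma pr_smul {c : ℂ} (hc : c ≠ 0) (v : ℂ × ℂ) : pr (c • v) = pr v := by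
  unfold pr
  simp only [Prod.smul_fst, Prod.smul_snd, smul_eq_mul, mul_eq_zero, hc, false_or]
  rw [mul_div_mul_left _ _ hc]

/-- crude upper bound of the distance by norms -/
lemma dist_pr_le {v w : ℂ × ℂ} (hv : v ≠ 0) (hw : w ≠ 0) :
    dist (pr v) (pr w) ≤ 4 * ‖v - w‖ / ‖v‖ := by
  have hv' := norm_pos_iff.2 hv
  have hw' := norm_pos_iff.2 hw
  have e : wg v w = (v.1 - w.1) * w.2 - (v.2 - w.2) * w.1 := by unfold wg; ring
  have h1 : ‖wg v w‖ ≤ 2 * ‖v - w‖ * ‖w‖ := by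
    rw [e]
    have a1 : ‖(v.1 - w.1) * w.2‖ ≤ ‖v - w‖ * ‖w‖ := by
      rw [norm_mul]; exact mul_le_mul (norm_fst_le (v - w)) (norm_snd_le w) (norm_nonneg _) (norm_nonneg _)
    have a2 : ‖(v.2 - w.2) * w.1‖ ≤ ‖v - w‖ * ‖w‖ := by
      rw [norm_mul]; exact mul_le_mul (norm_snd_le (v - w)) (norm_fst_le w) (norm_nonneg _) (norm_nonneg _)
    have := norm_sub_le ((v.1 - w.1) * w.2) ((v.2 - w.2) * w.1)
    linarith
  refine le_of_sq_le_sq ?_ (by positivity)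
  refine (dist_sq_le hv hw).trans ?_
  calc 4 * ‖wg v w‖ ^ 2 / (nn v * nn w) ≤ 4 * (2 * ‖v - w‖ * ‖w‖) ^ 2 / (‖v‖ ^ 2 * ‖w‖ ^ 2) := by
        have := nn_ge v
        have := nn_ge w
        have := nn_pos hv
        gcongr
    _ = (4 * ‖v - w‖ / ‖v‖) ^ 2 := by field_simp; ring

/-- the linear functional is controlled on nearby lines -/
lemma al_big {u w : ℂ × ℂ} (hu : u ≠ 0) (hw : w ≠ 0) (h : dist (pr w) (pr u) < 1 / 2) :
    7 / 8 * (nn u * nn w) ≤ ‖al u w‖ ^ 2 := by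
  have h1 := dist_sq_ge hu hw
  have h2 := al_wg u w
  have hp := mul_pos (nn_pos hu) (nn_pos hw)
  rw [dist_comm, div_le_iff₀ hp] at h1
  have h3 : dist (pr w) (pr u) ^ 2 < 1 / 4 := by
    have := dist_nonneg (x := pr w) (y := pr u); nlinarith
  nlinarith

lemma al_ne {u w : ℂ × ℂ} (hu : u ≠ 0) (hw : w ≠ 0) (h : dist (pr w) (pr u) < 1 / 2) :
    al u w ≠ 0 := by
  intro h0
  have := al_big hu hw h
  rw [h0] at this
  have hp := mul_pos (nn_pos hu) (nn_pos hw)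
  simp at this; linarith

lemma q_le_dist {u w : ℂ × ℂ} (hu : u ≠ 0) (hw : w ≠ 0) (h : dist (pr w) (pr u) < 1 / 2) :
    ‖wg u w / al u w‖ ≤ dist (pr w) (pr u) := by
  have h0 := al_ne hu hw h
  have h1 := al_big hu hw h
  have h2 := dist_sq_ge hu hw
  have hp := mul_pos (nn_pos hu) (nn_pos hw)
  rw [dist_comm, div_le_iff₀ hp] at h2
  have h0' := norm_pos_iff.2 h0
  refine le_of_sq_le_sq ?_ dist_nonneg
  rw [norm_div, div_pow, div_le_iff₀ (by positivity)]
  nlinarith [sq_nonneg (dist (pr w) (pr u)), mul_le_mul_of_nonneg_left h1 (sq_nonneg (dist (pr w) (pr u)))]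

lemma dist_le_q {u w w' : ℂ × ℂ} (hu : u ≠ 0) (hw : w ≠ 0) (hw' : w' ≠ 0)
    (h : al u w ≠ 0) (h' : al u w' ≠ 0) :
    dist (pr w) (pr w') ≤ 2 * ‖wg u w / al u w - wg u w' / al u w'‖ := by
  have e := wg_al u w w'
  have e2 : (nn u : ℂ) * wg w w' = - (al u w * al u w') * (wg u w / al u w - wg u w' / al u w') := by
    rw [e]; field_simp; ring
  have e3 := congrArg norm e2
  have pu := nn_pos hu
  have pw := nn_pos hw
  have pw' := nn_pos hw'
  rw [norm_mul, norm_mul, norm_neg, norm_mul, Complex.norm_real, Real.norm_eq_abs, abs_of_pos pu] at e3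
  set q := ‖wg u w / al u w - wg u w' / al u w'‖
  have a1 := al_wg u w
  have a2 := al_wg u w'
  have b1 : ‖al u w‖ ^ 2 ≤ nn u * nn w := by nlinarith [sq_nonneg ‖wg u w‖]
  have b2 : ‖al u w'‖ ^ 2 ≤ nn u * nn w' := by nlinarith [sq_nonneg ‖wg u w'‖]
  refine le_of_sq_le_sq ((dist_sq_le hw hw').trans ?_) (by positivity)
  rw [div_le_iff₀ (by positivity)]
  have e4 : nn u ^ 2 * ‖wg w w'‖ ^ 2 ≤ nn u ^ 2 * (q ^ 2 * (nn w * nn w')) := by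
    calc nn u ^ 2 * ‖wg w w'‖ ^ 2 = (nn u * ‖wg w w'‖) ^ 2 := by ring
      _ = (‖al u w‖ ^ 2 * ‖al u w'‖ ^ 2) * q ^ 2 := by rw [e3]; ring
      _ ≤ ((nn u * nn w) * (nn u * nn w')) * q ^ 2 := by gcongr
      _ = _ := by ring
  have := le_of_mul_le_mul_left e4 (by positivity)
  linarith

end UPJ
end UPJ

noncomputable section UPJ
open Set Metric Topology Filter MeasureTheory
open scoped UniformConvergence
namespace UPJ

structure IsLift (h : CSphere → CSphere) (F : ℂ × ℂ → ℂ × ℂ) (d : ℕ) : Prop where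
  diff : Differentiable ℂ F
  ne : ∀ v, v ≠ 0 → F v ≠ 0
  hom : ∀ (c : ℂ) v, F (c • v) = c ^ d • F v
  semi : ∀ v, v ≠ 0 → h (pr v) = pr (F v)

lemma IsLift.comp {h h' : CSphere → CSphere} {F F' : ℂ × ℂ → ℂ × ℂ} {d d' : ℕ}
    (H : IsLift h F d) (H' : IsLift h' F' d') : IsLift (h ∘ h') (F ∘ F') (d * d') where
  diff := H.diff.comp H'.diff
  ne := fun v hv => H.ne _ (H'.ne _ hv)
  hom := fun c v => by
    simp only [Function.comp]
    rw [H'.hom, H.hom, ← pow_mul, mul_comm]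
  semi := fun v hv => by
    simp only [Function.comp]
    rw [H'.semi v hv, H.semi _ (H'.ne _ hv)]

/-- homogenization -/
def hmg (p : Polynomial ℂ) (d : ℕ) (v : ℂ × ℂ) : ℂ :=
  ∑ i ∈ Finset.range (d + 1), p.coeff i * v.1 ^ i * v.2 ^ (d - i)

lemma hmg_diff (p : Polynomial ℂ) (d : ℕ) : Differentiable ℂ (hmg p d) := by
  unfold hmg
  fun_prop

lemma hmg_hom (p : Polynomial ℂ) (d : ℕ) (c : ℂ) (v : ℂ × ℂ) :
    hmg p d (c • v) = c ^ d * hmg p d v := by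
  unfold hmg
  rw [Finset.mul_sum]
  refine Finset.sum_congr rfl fun i hi => ?_
  have : d = i + (d - i) := by simp at hi; omega
  simp only [Prod.smul_fst, Prod.smul_snd, smul_eq_mul, mul_pow]
  conv_rhs => rw [this, pow_add]
  simp
  ring

lemma hmg_ne (p : Polynomial ℂ) (d : ℕ) (hd : p.natDegree ≤ d) {v : ℂ × ℂ} (hv : v.2 ≠ 0) :
    hmg p d v = v.2 ^ d * p.eval (v.1 / v.2) := by
  unfold hmg
  rw [Polynomial.eval_eq_sum_range' (Nat.lt_succ_of_le hd), Finset.mul_sum]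
  refine Finset.sum_congr rfl fun i hi => ?_
  have : d = i + (d - i) := by simp at hi; omega
  conv_rhs => rw [this, pow_add]
  rw [div_pow]
  field_simp

lemma hmg_zero (p : Polynomial ℂ) (d : ℕ) (v : ℂ × ℂ) (hv : v.2 = 0) :
    hmg p d v = p.coeff d * v.1 ^ d := by
  unfold hmg
  rw [Finset.sum_eq_single d]
  · simp
  · intro i hi hid
    have : d - i ≠ 0 := by simp at hi; omega
    simp [hv, this]
  · simp

lemma exists_lift {h : CSphere → CSphere} {n : ℕ} (hn : 2 ≤ n) (hh : CSphere.ratDegEq h n) :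
    ∃ F, IsLift h F n := by
  obtain ⟨p, q, ⟨hq, hc, rfl⟩, hd⟩ := hh
  have hp : p.natDegree ≤ n := hd ▸ le_max_left _ _
  have hqn : q.natDegree ≤ n := hd ▸ le_max_right _ _
  have hp0 : p ≠ 0 := by
    rintro rfl
    have : IsUnit q := isCoprime_zero_left.1 hc
    have := Polynomial.natDegree_eq_zero_of_isUnit this
    simp [this] at hd; omega
  have hone : p.coeff n ≠ 0 ∨ q.coeff n ≠ 0 := by
    rcases max_choice p.natDegree q.natDegree with h | h
    · left; rw [← hd, h]; simpa using hp0
    · right; rw [← hd, h]; simpa using hq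
  have hnv : ∀ v : ℂ × ℂ, v ≠ 0 → (hmg p n v, hmg q n v) ≠ 0 := by
    intro v hv h0
    have h1 : hmg p n v = 0 := congrArg Prod.fst h0
    have h2 : hmg q n v = 0 := congrArg Prod.snd h0
    by_cases hv2 : v.2 = 0
    · have hv1 : v.1 ≠ 0 := fun h => hv (Prod.ext h hv2)
      rw [hmg_zero _ _ _ hv2] at h1 h2
      have : v.1 ^ n ≠ 0 := pow_ne_zero _ hv1
      rcases hone with h | h <;> simp_all
    · rw [hmg_ne _ _ hp hv2] at h1
      rw [hmg_ne _ _ hqn hv2] at h2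
      have : v.2 ^ n ≠ 0 := pow_ne_zero _ hv2
      obtain ⟨a, b, hab⟩ := hc
      have h3 := congrArg (Polynomial.eval (v.1 / v.2)) hab
      have h1' := (mul_eq_zero.1 h1).resolve_left this
      have h2' := (mul_eq_zero.1 h2).resolve_left this
      rw [Polynomial.eval_add, Polynomial.eval_mul, Polynomial.eval_mul, h1', h2'] at h3
      simp at h3
  refine ⟨fun v => (hmg p n v, hmg q n v), ?_, hnv, ?_, ?_⟩
  · exact (hmg_diff p n).prodMk (hmg_diff q n)
  · intro c v
    simp [hmg_hom]
  · intro v hv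
    by_cases hv2 : v.2 = 0
    · have hv1 : v.1 ≠ 0 := fun h => hv (Prod.ext h hv2)
      have e1 : pr v = CSphere.infty := by simp [pr, hv2]
      have e2 : CSphere.ratLift p q CSphere.infty = (if q.natDegree < p.natDegree then CSphere.infty
        else if p.natDegree < q.natDegree then CSphere.ofC 0
        else CSphere.ofC (p.leadingCoeff / q.leadingCoeff)) := rfl
      have hx : v.1 ^ n ≠ 0 := pow_ne_zero _ hv1
      rw [e1, e2]
      unfold pr
      simp only [hmg_zero _ _ _ hv2]
      rcases lt_trichotomy q.natDegree p.natDegree with h | h | h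
      · have : q.coeff n = 0 := Polynomial.coeff_eq_zero_of_natDegree_lt (by rw [← hd]; simp [h])
        simp [h, this]
      · have hqe : q.natDegree = n := by rw [← hd]; simp [h]
        have hpe : p.natDegree = n := by omega
        have : q.coeff n ≠ 0 := by rw [← hqe]; simpa using hq
        simp only [h, lt_irrefl, if_false, mul_eq_zero, this, hx, or_self]
        rw [mul_div_mul_right _ _ hx]
        unfold Polynomial.leadingCoeff
        rw [hqe, hpe]
      · have hqe : q.natDegree = n := by rw [← hd]; simp [h.le]
        have hpc : p.coeff n = 0 := Polynomial.coeff_eq_zero_of_natDegree_lt (by omega)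
        have : q.coeff n ≠ 0 := by rw [← hqe]; simpa using hq
        simp [h, not_lt.2 h.le, hpc, this, hx]
    · have e1 : pr v = CSphere.ofC (v.1 / v.2) := by simp [pr, hv2]
      have e2 : CSphere.ratLift p q (CSphere.ofC (v.1 / v.2)) =
        (if q.eval (v.1 / v.2) = 0 then CSphere.infty
          else CSphere.ofC (p.eval (v.1 / v.2) / q.eval (v.1 / v.2))) := rfl
      rw [e1, e2]
      unfold pr
      have hx : v.2 ^ n ≠ 0 := pow_ne_zero _ hv2
      simp only [hmg_ne _ _ hp hv2, hmg_ne _ _ hqn hv2, mul_eq_zero, hx, false_or]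
      rw [mul_div_mul_left _ _ hx]

/-- the lift is bounded above and below on homogeneous rays (crude) -/
lemma IsLift.bound {h : CSphere → CSphere} {F : ℂ × ℂ → ℂ × ℂ} {d : ℕ} (H : IsLift h F d) :
    ∃ v₀, ‖v₀‖ = 1 ∧ ∀ v, v ≠ 0 → ‖F v‖ ≤ ‖F v₀‖ * ‖v‖ ^ d := by
  have hc : IsCompact (sphere (0 : ℂ × ℂ) 1) := isCompact_sphere _ _
  have hne : (sphere (0 : ℂ × ℂ) 1).Nonempty := ⟨(1, 1), by simp [Prod.norm_def]⟩
  obtain ⟨v₀, h1, h2⟩ := hc.exists_isMaxOn hne (H.diff.continuous.norm.continuousOn)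
  refine ⟨v₀, by simpa using h1, fun v hv => ?_⟩
  have hv' := norm_pos_iff.2 hv
  have hm : ((‖v‖⁻¹ : ℝ) : ℂ) • v ∈ sphere (0 : ℂ × ℂ) 1 := by
    simp [norm_smul, hv'.ne']
  have := h2 hm
  simp only [mem_ofPred_eq] at this
  rw [H.hom, norm_smul, norm_pow, Complex.norm_real, norm_inv, norm_norm] at this
  rw [inv_pow, inv_mul_le_iff₀ (by positivity)] at this
  linarith

/-- Every rational map in the class is continuous. -/
lemma IsLift.continuous {h : CSphere → CSphere} {F : ℂ × ℂ → ℂ × ℂ} {d : ℕ} (H : IsLift h F d) :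
    Continuous h := by
  rw [Metric.continuous_iff]
  intro b ε hε
  obtain ⟨u, hu, hu1, rfl⟩ := pr_surj b
  -- continuity of `F` at `u`
  have hFu := norm_pos_iff.2 (H.ne u hu)
  have hcont := Metric.continuous_iff.1 H.diff.continuous u (ε * ‖F u‖ / 8) (by positivity)
  obtain ⟨δ, hδ, hF⟩ := hcont
  refine ⟨min (1 / 2) (δ / 4), by positivity, fun a ha => ?_⟩
  obtain ⟨w, hw, hw1, rfl⟩ := pr_surj a
  have hd2 : dist (pr w) (pr u) < 1 / 2 := ha.trans_le (min_le_left _ _)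
  have hd3 : dist (pr w) (pr u) < δ / 4 := ha.trans_le (min_le_right _ _)
  have hal := al_ne hu hw hd2
  have hq := q_le_dist hu hw hd2
  -- rescale `w`
  set w' := (al u w)⁻¹ • w with hw'
  have hw'0 : w' ≠ 0 := smul_ne_zero (inv_ne_zero hal) hw
  have hprw : pr w' = pr w := pr_smul (inv_ne_zero hal) w
  have hclose : dist w' u < δ := by
    -- w' - u = (β/α) * (-conj u.2, conj u.1)
    set q := wg u w / al u w with hqd
    have hnu : u.1 * (starRingEnd ℂ) u.1 + u.2 * (starRingEnd ℂ) u.2 = 1 := by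
      rw [Complex.mul_conj, Complex.mul_conj, Complex.normSq_eq_norm_sq, Complex.normSq_eq_norm_sq]
      exact_mod_cast hu1
    have e1 : w'.1 - u.1 = - q * (starRingEnd ℂ) u.2 := by
      simp only [hw', hqd, Prod.smul_fst, smul_eq_mul]
      field_simp
      unfold wg al
      linear_combination (-w.1) * hnu
    have e2 : w'.2 - u.2 = q * (starRingEnd ℂ) u.1 := by
      simp only [hw', hqd, Prod.smul_snd, smul_eq_mul]
      field_simp
      unfold wg al
      linear_combination (-w.2) * hnu
    have hu1' : ‖u.1‖ ≤ 1 := by unfold nn at hu1; nlinarith [sq_nonneg ‖u.2‖, norm_nonneg u.1]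
    have hu2' : ‖u.2‖ ≤ 1 := by unfold nn at hu1; nlinarith [sq_nonneg ‖u.1‖, norm_nonneg u.2]
    rw [dist_eq_norm, Prod.norm_def]
    apply max_lt
    · rw [Prod.fst_sub, e1]
      simp only [norm_mul, norm_neg, RCLike.norm_conj]
      nlinarith [norm_nonneg q, norm_nonneg u.2]
    · rw [Prod.snd_sub, e2]
      simp only [norm_mul, RCLike.norm_conj]
      nlinarith [norm_nonneg q, norm_nonneg u.1]
  have h3 := hF w' hclose
  rw [← hprw, H.semi _ hw'0, H.semi _ hu, dist_comm]
  refine (dist_pr_le (H.ne _ hu) (H.ne _ hw'0)).trans_lt ?_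
  rw [div_lt_iff₀ hFu, ← dist_eq_norm, dist_comm]
  linarith [mul_pos hε hFu]

end UPJ
end UPJ

noncomputable section UPJ
open Set Metric Topology Filter MeasureTheory
open scoped UniformConvergence
namespace UPJ

lemma exists_log {f : ℂ → ℂ} {z : ℂ} {R : ℝ} (hf : DifferentiableOn ℂ f (ball z R))
    (h0 : ∀ w ∈ ball z R, f w ≠ 0) :
    ∃ g : ℂ → ℂ, DifferentiableOn ℂ g (ball z R) ∧ (∀ w ∈ ball z R, (g w).re = Real.log ‖f w‖) ∧
      (g z).im = 0 := by
  have hh : InnerProductSpace.HarmonicOnNhd (fun w => Real.log ‖f w‖) (ball z R) := by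
    intro w hw
    exact (hf.analyticAt (isOpen_ball.mem_nhds hw)).harmonicAt_log_norm (h0 w hw)
  obtain ⟨F, hF, hE⟩ := hh.exists_analyticOnNhd_ball_re_eq
  refine ⟨fun w => F w - ((F z).im : ℂ) * Complex.I, ?_, ?_, ?_⟩
  · exact hF.differentiableOn.sub_const _
  · intro w hw
    have := hE hw
    simp at this ⊢
    exact this
  · simp

lemma harnack {f : ℂ → ℂ} (hf : DifferentiableOn ℂ f (ball 0 2))
    (h0 : ∀ w ∈ ball (0:ℂ) 2, f w ≠ 0) {B : ℝ} (hB : ∀ w ∈ ball (0:ℂ) 2, Real.log ‖f w‖ ≤ B) :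
    B - Real.log ‖f 1‖ ≤ 3 * (B - Real.log ‖f 0‖) := by
  obtain ⟨g, hg, hre, him⟩ := exists_log hf h0
  have m0 : (0:ℂ) ∈ ball (0:ℂ) 2 := by simp
  have m1 : (1:ℂ) ∈ ball (0:ℂ) 2 := by simp
  have key : ∀ M > 0, B - Real.log ‖f 1‖ ≤ 2 * M + 3 * (B - Real.log ‖f 0‖) := by
    intro M hM
    have := Complex.borelCaratheodory (f := fun w => g w - B) (R := 2) (z := 1) hM (hg.sub_const _)
      (by intro w hw; have := hB w hw; rw [← hre w hw] at this; simp; linarith) (by norm_num) m1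
    have e0 : g 0 - B = ((Real.log ‖f 0‖ - B : ℝ) : ℂ) := by
      apply Complex.ext
      · simp [hre 0 m0]
      · simp [him]
    have e1 : B - Real.log ‖f 1‖ ≤ ‖g 1 - B‖ := by
      have := Complex.abs_re_le_norm (g 1 - B)
      rw [Complex.sub_re, hre 1 m1, Complex.ofReal_re] at this
      have := neg_le_of_abs_le this
      linarith
    rw [e0, Complex.norm_real, Real.norm_eq_abs, abs_of_nonpos (by linarith [hB 0 m0]), norm_one] at this
    linarith
  refine le_of_forall_pos_le_add fun ε hε => ?_
  have := key (ε / 2) (by linarith)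
  linarith

lemma small_re {g : ℂ → ℂ} {z : ℂ} {ρ ε : ℝ} (hρ : 0 < ρ) (hε : 0 < ε)
    (hg : DifferentiableOn ℂ g (ball z ρ))
    (hre : ∀ w ∈ ball z ρ, |(g w).re| ≤ ε) (him : (g z).im = 0) :
    ∀ w ∈ ball z (ρ / 2), ‖g w‖ ≤ 5 * ε := by
  intro w hw
  have hw' : ‖w - z‖ < ρ / 2 := by simpa [dist_eq_norm] using hw
  have hmap : MapsTo (fun x => z + x) (ball (0:ℂ) ρ) (ball z ρ) := by
    intro x hx; simpa using hx
  have := Complex.borelCaratheodory (f := fun x => g (z + x)) (R := ρ) (z := w - z) hε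
      (hg.comp (by fun_prop) hmap)
      (by intro x hx; exact le_of_abs_le (hre _ (hmap hx))) hρ
      (by simp; linarith)
  simp only [add_sub_cancel, add_zero] at this
  have e0 : ‖g z‖ ≤ ε := by
    have : g z = (((g z).re : ℝ) : ℂ) := by apply Complex.ext <;> simp [him]
    rw [this, Complex.norm_real]
    exact hre z (mem_ball_self hρ)
  have hp : 0 < ρ - ‖w - z‖ := by linarith
  have b1 : 2 * ε * ‖w - z‖ / (ρ - ‖w - z‖) ≤ 2 * ε := by
    rw [div_le_iff₀ hp]; nlinarith
  have b2 : ‖g z‖ * (ρ + ‖w - z‖) / (ρ - ‖w - z‖) ≤ 3 * ε := by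
    rw [div_le_iff₀ hp]
    nlinarith [norm_nonneg (w - z), norm_nonneg (g z)]
  linarith

lemma harmonic_limit {u : ℂ → ℝ} {z : ℂ} {ρ : ℝ} (hρ : 0 < ρ) (ε : ℕ → ℝ)
    (hε : Tendsto ε atTop (𝓝 0)) (g : ℕ → ℂ → ℂ)
    (hg : ∀ n, DifferentiableOn ℂ (g n) (ball z ρ))
    (him : ∀ n, (g n z).im = 0)
    (hre : ∀ n, ∀ w ∈ ball z ρ, |(g n w).re - u w| ≤ ε n) :
    InnerProductSpace.HarmonicAt u z := by
  have hU : UniformCauchySeqOn g atTop (ball z (ρ / 2)) := by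
    rw [Metric.uniformCauchySeqOn_iff]
    intro e he
    have : ∀ᶠ n in atTop, ε n < e / 20 := hε.eventually (gt_mem_nhds (by linarith))
    obtain ⟨N, hN⟩ := eventually_atTop.1 this
    refine ⟨N, fun m hm n hn x hx => ?_⟩
    rw [dist_eq_norm]
    have := small_re (g := fun w => g m w - g n w) hρ (ε := e / 10) (by linarith)
      ((hg m).sub (hg n)) (by
        intro w hw
        have a := abs_le.1 (hre m w hw)
        have b := abs_le.1 (hre n w hw)
        have c := hN m hm
        have d := hN n hn
        rw [Complex.sub_re, abs_le]
        constructor <;> linarith) (by simp [him]) x hx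
    linarith
  have hlim : ∀ x ∈ ball z (ρ / 2), ∃ y, Tendsto (fun n => g n x) atTop (𝓝 y) := fun x hx =>
    cauchySeq_tendsto_of_complete (hU.cauchySeq hx)
  choose! G hG using hlim
  have hT : TendstoUniformlyOn g G atTop (ball z (ρ / 2)) :=
    hU.tendstoUniformlyOn_of_tendsto hG
  have hD : DifferentiableOn ℂ G (ball z (ρ / 2)) :=
    hT.tendstoLocallyUniformlyOn.differentiableOn
      (Eventually.of_forall fun n => (hg n).mono (ball_subset_ball (by linarith))) isOpen_ball
  have hA : AnalyticAt ℂ G z := hD.analyticAt (ball_mem_nhds _ (by linarith))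
  have := hA.harmonicAt_re
  rw [InnerProductSpace.harmonicAt_congr_nhds (f₂ := fun x => (G x).re)]
  · exact this
  · filter_upwards [ball_mem_nhds z (half_pos hρ)] with x hx
    have t1 : Tendsto (fun n => (g n x).re) atTop (𝓝 (G x).re) :=
      (Complex.continuous_re.tendsto _).comp (hG x hx)
    have t2 : Tendsto (fun n => (g n x).re) atTop (𝓝 (u x)) := by
      rw [tendsto_iff_dist_tendsto_zero]
      exact squeeze_zero (fun _ => dist_nonneg)
        (fun n => hre n x (ball_subset_ball (by linarith) hx)) hε
    exact tendsto_nhds_unique t2 t1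

end UPJ
end UPJ

noncomputable section UPJ
open Set Metric Topology Filter MeasureTheory
open scoped UniformConvergence
namespace UPJ

lemma al_diff (u : ℂ × ℂ) : Differentiable ℂ (al u) := by
  unfold al; fun_prop

lemma wg_diff (u : ℂ × ℂ) : Differentiable ℂ (wg u) := by
  unfold wg; fun_prop

lemma log_al_le {u w : ℂ × ℂ} (hu : u ≠ 0) (hw : w ≠ 0) (ha : al u w ≠ 0) :
    Real.log ‖al u w‖ ≤ Real.log ‖u‖ + Real.log ‖w‖ + Real.log 2 := by
  have hu' := norm_pos_iff.2 hu
  have hw' := norm_pos_iff.2 hw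
  rw [← Real.log_mul hu'.ne' hw'.ne', ← Real.log_mul (by positivity) (by norm_num)]
  apply Real.log_le_log (norm_pos_iff.2 ha)
  refine le_of_sq_le_sq ?_ (by positivity)
  have h1 := al_wg u w
  have h2 := nn_le u
  have h3 := nn_le w
  calc ‖al u w‖ ^ 2 ≤ nn u * nn w := by nlinarith [sq_nonneg ‖wg u w‖]
    _ ≤ (2 * ‖u‖ ^ 2) * (2 * ‖w‖ ^ 2) := by
        have := nn_pos hw
        gcongr
    _ = _ := by ring

lemma log_al_ge {u w : ℂ × ℂ} (hu : u ≠ 0) (hw : w ≠ 0) (h : dist (pr w) (pr u) < 1 / 2) :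
    Real.log ‖u‖ + Real.log ‖w‖ - Real.log 2 ≤ Real.log ‖al u w‖ := by
  have hu' := norm_pos_iff.2 hu
  have hw' := norm_pos_iff.2 hw
  rw [← Real.log_mul hu'.ne' hw'.ne', ← Real.log_div (by positivity) (by norm_num)]
  apply Real.log_le_log (by positivity)
  refine le_of_sq_le_sq ?_ (by positivity)
  have h1 := al_big hu hw h
  have h2 := nn_ge u
  have h3 := nn_ge w
  have : ‖u‖ ^ 2 * ‖w‖ ^ 2 ≤ nn u * nn w := by
    have := nn_pos hu
    gcongr
  have : (0:ℝ) ≤ ‖u‖ ^ 2 * ‖w‖ ^ 2 := by positivity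
  have e : (‖u‖ * ‖w‖ / 2) ^ 2 = ‖u‖ ^ 2 * ‖w‖ ^ 2 / 4 := by ring
  rw [e]; linarith

lemma step {h : CSphere → CSphere} {F : ℂ × ℂ → ℂ × ℂ} {d : ℕ} (hd : 1 ≤ d) (H : IsLift h F d)
    {A : ℝ} (hA : ∀ v, v ≠ 0 → Real.log ‖F v‖ ≤ A + d * Real.log ‖v‖) {x y : ℂ × ℂ}
    (hx : ‖x‖ ≤ 1) (hx2 : 1 / 8 ≤ ‖x‖) (hxy : ‖y - x‖ ≤ 1 / 2)
    (hne : ∀ ζ ∈ ball (0:ℂ) 2, x + ζ • (y - x) ≠ 0)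
    (hcl : ∀ ζ ∈ ball (0:ℂ) 2, dist (h (pr (x + ζ • (y - x)))) (h (pr x)) < 1 / 2) :
    A + d * Real.log ‖y‖ - Real.log ‖F y‖ ≤
      3 * (A + d * Real.log ‖x‖ - Real.log ‖F x‖) + 18 * Real.log 2 * d := by
  have m0 : (0:ℂ) ∈ ball (0:ℂ) 2 := by simp
  have m1 : (1:ℂ) ∈ ball (0:ℂ) 2 := by simp
  have hx0 : x ≠ 0 := by simpa using hne 0 m0
  have hy0 : y ≠ 0 := by simpa using hne 1 m1
  have hd' : (1:ℝ) ≤ d := by exact_mod_cast hd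
  have hl2 : 0 < Real.log 2 := Real.log_pos (by norm_num)
  set u := F x with hu
  have hu0 : u ≠ 0 := H.ne _ hx0
  set e : ℂ → ℂ := fun ζ => al u (F (x + ζ • (y - x))) with he
  have hcl' : ∀ ζ ∈ ball (0:ℂ) 2, dist (pr (F (x + ζ • (y - x)))) (pr u) < 1 / 2 := by
    intro ζ hζ
    rw [← H.semi _ (hne ζ hζ), hu, ← H.semi _ hx0]; exact hcl ζ hζ
  have hene : ∀ ζ ∈ ball (0:ℂ) 2, e ζ ≠ 0 := fun ζ hζ =>
    al_ne hu0 (H.ne _ (hne ζ hζ)) (hcl' ζ hζ)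
  have hed : DifferentiableOn ℂ e (ball 0 2) := by
    apply Differentiable.differentiableOn
    exact (al_diff u).comp (H.diff.comp (by fun_prop))
  have hnorm : ∀ ζ ∈ ball (0:ℂ) 2, ‖x + ζ • (y - x)‖ ≤ 2 := by
    intro ζ hζ
    have hz : ‖ζ‖ < 2 := by simpa using hζ
    have h1 := norm_add_le x (ζ • (y - x))
    rw [norm_smul] at h1
    nlinarith [norm_nonneg ζ, norm_nonneg (y - x)]
  have hB : ∀ ζ ∈ ball (0:ℂ) 2, Real.log ‖e ζ‖ ≤ Real.log ‖u‖ + Real.log 2 + A + d * Real.log 2 := by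
    intro ζ hζ
    have h1 := log_al_le hu0 (H.ne _ (hne ζ hζ)) (hene ζ hζ)
    have h2 := hA _ (hne ζ hζ)
    have h3 : Real.log ‖x + ζ • (y - x)‖ ≤ Real.log 2 :=
      Real.log_le_log (norm_pos_iff.2 (hne ζ hζ)) (hnorm ζ hζ)
    have h4 : (d:ℝ) * Real.log ‖x + ζ • (y - x)‖ ≤ d * Real.log 2 := by gcongr
    simp only [he]; linarith
  have hh := harnack hed hene hB
  have e1 : e 1 = al u (F y) := by simp [he]
  have e0 : e 0 = al u (F x) := by simp [he]
  have c1 : Real.log ‖e 1‖ ≤ _ := e1 ▸ log_al_le hu0 (H.ne _ hy0) (e1 ▸ hene 1 m1)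
  have c0 := log_al_ge hu0 (H.ne _ hx0) (by simp [hu])
  rw [← e0] at c0
  have ny : ‖y‖ ≤ 2 := by simpa using hnorm 1 m1
  have ly : (d:ℝ) * Real.log ‖y‖ ≤ d * Real.log 2 := by
    gcongr
  have lx : - 3 * Real.log 2 ≤ Real.log ‖x‖ := by
    have := Real.log_le_log (by norm_num) hx2
    have e8 : Real.log (1 / 8) = - 3 * Real.log 2 := by
      rw [show (1 / 8 : ℝ) = (2 ^ 3)⁻¹ by norm_num, Real.log_inv, Real.log_pow]; push_cast; ring
    linarith
  have lx' : (d:ℝ) * (- 3 * Real.log 2) ≤ d * Real.log ‖x‖ := by gcongr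
  have : Real.log 2 ≤ d * Real.log 2 := by nlinarith
  rw [← hu] at c0
  linarith

lemma seg {v w : ℂ × ℂ} (hv : ‖v‖ = 1) (hw : ‖w‖ = 1) :
    (∀ t : ℝ, 0 ≤ t → t ≤ 1 → 1 / 8 ≤ ‖(1 - t) • v + t • w‖) ∨
    (∀ t : ℝ, 0 ≤ t → t ≤ 1 → 1 / 8 ≤ ‖(1 - t) • v + t • (-w)‖) := by
  by_contra hcon
  push Not at hcon
  obtain ⟨⟨t, t0, t1, ht⟩, ⟨s, s0, s1, hs⟩⟩ := hcon
  have key : ∀ (t : ℝ) (w : ℂ × ℂ), ‖w‖ = 1 → 0 ≤ t → t ≤ 1 → ‖(1 - t) • v + t • w‖ < 1 / 8 →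
      7 / 16 < t ∧ t < 9 / 16 := by
    intro t w hw t0 t1 ht
    have a1 := norm_sub_le ((1 - t) • v + t • w) (t • w)
    have a2 := norm_sub_le ((1 - t) • v + t • w) ((1 - t) • v)
    rw [add_sub_cancel_right, norm_smul, norm_smul, hv, hw, Real.norm_eq_abs, Real.norm_eq_abs,
      abs_of_nonneg t0, abs_of_nonneg (by linarith)] at a1
    rw [add_sub_cancel_left, norm_smul, norm_smul, hv, hw, Real.norm_eq_abs, Real.norm_eq_abs,
      abs_of_nonneg t0, abs_of_nonneg (by linarith)] at a2
    constructor <;> linarith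
  obtain ⟨k1, k2⟩ := key t w hw t0 t1 ht
  obtain ⟨k3, k4⟩ := key s (-w) (by simpa using hw) s0 s1 hs
  have e : (s * (1 - t) + t * (1 - s)) • v = s • ((1 - t) • v + t • w) + t • ((1 - s) • v + s • (-w)) := by
    module
  have e2 := congrArg norm e
  rw [norm_smul, hv, Real.norm_eq_abs, abs_of_nonneg (by nlinarith)] at e2
  have e3 := norm_add_le (s • ((1 - t) • v + t • w)) (t • ((1 - s) • v + s • (-w)))
  rw [norm_smul, norm_smul, Real.norm_eq_abs, Real.norm_eq_abs, abs_of_nonneg t0, abs_of_nonneg s0] at e3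
  nlinarith

def Good (K : ℝ) (h : CSphere → CSphere) : Prop :=
  ∃ F d, 2 ≤ d ∧ IsLift h F d ∧ ∀ v, v ≠ 0 → |Real.log ‖F v‖ - d * Real.log ‖v‖| ≤ K * (d - 1)

lemma chain {h : CSphere → CSphere} {F : ℂ × ℂ → ℂ × ℂ} {d : ℕ} (hd : 1 ≤ d) (H : IsLift h F d)
    {A δ : ℝ} (hA : ∀ v, v ≠ 0 → Real.log ‖F v‖ ≤ A + d * Real.log ‖v‖)
    (heq : ∀ x y, dist x y < δ → dist (h x) (h y) < 1 / 2) {N : ℕ} (hN : 32 < N) (hN' : 128 / δ < N)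
    (hδ : 0 < δ) {v w : ℂ × ℂ} (hv : ‖v‖ = 1) (hw : ‖w‖ = 1)
    (hseg : ∀ t : ℝ, 0 ≤ t → t ≤ 1 → 1 / 8 ≤ ‖(1 - t) • v + t • w‖)
    (hv0 : A - Real.log ‖F v‖ ≤ 0) :
    A - Real.log ‖F w‖ ≤ 18 * Real.log 2 * d * 3 ^ N := by
  have hl2 : 0 < Real.log 2 := Real.log_pos (by norm_num)
  have hNr : (32:ℝ) < N := by exact_mod_cast hN
  have hNp : (0:ℝ) < N := by linarith
  set X : ℕ → ℂ × ℂ := fun k => (1 - (k:ℝ) / N) • v + ((k:ℝ) / N) • w with hX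
  have hX8 : ∀ k ≤ N, 1 / 8 ≤ ‖X k‖ := fun k hk =>
    hseg _ (by positivity) (by rw [div_le_one hNp]; exact_mod_cast hk)
  have hX1 : ∀ k ≤ N, ‖X k‖ ≤ 1 := by
    intro k hk
    have t1 : (k:ℝ) / N ≤ 1 := by rw [div_le_one hNp]; exact_mod_cast hk
    have t0 : 0 ≤ (k:ℝ) / N := by positivity
    refine (norm_add_le _ _).trans ?_
    rw [norm_smul, norm_smul, hv, hw, Real.norm_eq_abs, Real.norm_eq_abs, abs_of_nonneg t0,
      abs_of_nonneg (by linarith)]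
    linarith
  have hstep : ∀ k, ‖X (k + 1) - X k‖ ≤ 2 / N := by
    intro k
    have : X (k + 1) - X k = (1 / (N:ℝ)) • (w - v) := by
      simp only [hX]
      have : ((k + 1 : ℕ) : ℝ) / N = (k:ℝ) / N + 1 / N := by push_cast; ring
      rw [this]
      module
    rw [this, norm_smul, Real.norm_eq_abs, abs_of_nonneg (by positivity)]
    have := norm_sub_le w v
    rw [hv, hw] at this
    rw [div_mul_eq_mul_div, one_mul]
    gcongr
    linarith
  have main : ∀ k ≤ N, A + d * Real.log ‖X k‖ - Real.log ‖F (X k)‖ ≤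
      18 * Real.log 2 * d * (3 ^ k - 1) := by
    intro k
    induction k with
    | zero =>
      intro _
      simp [hX, hv]; linarith
    | succ k ih =>
      intro hk
      have ih := ih (by omega)
      have h8 := hX8 k (by omega)
      have hx0 : X k ≠ 0 := by rw [← norm_pos_iff]; linarith
      have hsm : ∀ ζ ∈ ball (0:ℂ) 2, ‖ζ • (X (k + 1) - X k)‖ ≤ 4 / N := by
        intro ζ hζ
        have hz : ‖ζ‖ < 2 := by simpa using hζ
        rw [norm_smul]
        calc ‖ζ‖ * ‖X (k + 1) - X k‖ ≤ 2 * (2 / N) := by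
              gcongr; exact hstep k
          _ = 4 / N := by ring
      have h4N : 4 / (N:ℝ) < 1 / 8 := by rw [div_lt_div_iff₀ hNp (by norm_num)]; linarith
      have hne : ∀ ζ ∈ ball (0:ℂ) 2, X k + ζ • (X (k + 1) - X k) ≠ 0 := by
        intro ζ hζ h0
        have h1 := hsm ζ hζ
        have : ζ • (X (k + 1) - X k) = - X k := by rw [eq_neg_iff_add_eq_zero, add_comm]; exact h0
        rw [this, norm_neg] at h1
        linarith
      have := step hd H hA (hX1 k (by omega)) h8
        ((hstep k).trans (by rw [div_le_div_iff₀ hNp (by norm_num)]; linarith)) hne (by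
          intro ζ hζ
          apply heq
          rw [dist_comm]
          refine (dist_pr_le hx0 (hne ζ hζ)).trans_lt ?_
          rw [sub_add_cancel_left, norm_neg]
          have h1 := hsm ζ hζ
          calc 4 * ‖ζ • (X (k + 1) - X k)‖ / ‖X k‖ ≤ 4 * (4 / N) / (1 / 8) := by gcongr
            _ = 128 / N := by ring
            _ < δ := by rw [div_lt_iff₀ hNp]; rw [div_lt_iff₀ hδ] at hN'; linarith)
      have hd' : (1:ℝ) ≤ d := by exact_mod_cast hd
      have hp : 0 < 18 * Real.log 2 * (d:ℝ) := by positivity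
      have e : 18 * Real.log 2 * d * (3 ^ (k + 1) - 1) =
        3 * (18 * Real.log 2 * d * (3 ^ k - 1)) + 2 * (18 * Real.log 2 * d) := by ring
      rw [e]
      linarith
  have hfin := main N le_rfl
  have : X N = w := by simp [hX, hNp.ne']
  rw [this, hw] at hfin
  have hp : 0 ≤ 18 * Real.log 2 * (d:ℝ) := by positivity
  simp at hfin
  linarith

lemma uniform_good (S : Set (CSphere → CSphere)) (hS : ∀ h ∈ S, ∃ F d, 2 ≤ d ∧ IsLift h F d)
    {δ : ℝ} (hδ : 0 < δ) (heq : ∀ h ∈ S, ∀ x y, dist x y < δ → dist (h x) (h y) < 1 / 2) :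
    ∃ K, 0 ≤ K ∧ ∀ h ∈ S, Good K h := by
  obtain ⟨N, hN⟩ := exists_nat_gt (max 32 (128 / δ))
  have hN1 : 32 < N := by
    have := (le_max_left _ _).trans_lt hN
    exact_mod_cast this
  have hN2 := (le_max_right _ _).trans_lt hN
  have hl2 : 0 < Real.log 2 := Real.log_pos (by norm_num)
  refine ⟨2 * (18 * Real.log 2 * 3 ^ N), by positivity, fun h hh => ?_⟩
  obtain ⟨F, d, hd, H⟩ := hS h hh
  obtain ⟨v₀, hv0, hmax⟩ := H.bound
  have hv00 : v₀ ≠ 0 := by rw [← norm_pos_iff]; linarith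
  have hF0 := norm_pos_iff.2 (H.ne _ hv00)
  set A := Real.log ‖F v₀‖ with hAd
  have hA : ∀ v, v ≠ 0 → Real.log ‖F v‖ ≤ A + d * Real.log ‖v‖ := by
    intro v hv
    have hv' := norm_pos_iff.2 hv
    rw [hAd, ← Real.log_pow, ← Real.log_mul hF0.ne' (by positivity)]
    exact Real.log_le_log (norm_pos_iff.2 (H.ne _ hv)) (hmax v hv)
  have hunit : ∀ w, ‖w‖ = 1 → A - Real.log ‖F w‖ ≤ 18 * Real.log 2 * d * 3 ^ N := by
    intro w hw
    rcases seg hv0 hw with hs | hs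
    · exact chain (by omega) H hA (heq h hh) hN1 hN2 hδ hv0 hw hs (by simp [hAd])
    · have := chain (by omega) H hA (heq h hh) hN1 hN2 hδ hv0 (w := -w) (by simpa using hw) hs
        (by simp [hAd])
      have e : F (-w) = (-1 : ℂ) ^ d • F w := by rw [← H.hom]; simp
      rw [e, norm_smul, norm_pow, norm_neg, norm_one, one_pow, one_mul] at this
      exact this
  set c : ℂ := ((‖F v₀‖⁻¹ : ℝ) : ℂ) with hc
  have hc0 : c ≠ 0 := by
    rw [hc]; exact_mod_cast (inv_pos.2 hF0).ne'
  have hcn : ‖c‖ = ‖F v₀‖⁻¹ := by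
    rw [hc, Complex.norm_real, norm_inv, norm_norm]
  refine ⟨fun v => c • F v, d, hd, ⟨H.diff.const_smul c, fun v hv => smul_ne_zero hc0 (H.ne v hv), ?_, ?_⟩, ?_⟩
  · intro a v; rw [H.hom, smul_comm]
  · intro v hv; rw [pr_smul hc0]; exact H.semi v hv
  · intro v hv
    have hv' := norm_pos_iff.2 hv
    have hFv := norm_pos_iff.2 (H.ne _ hv)
    have h1 := hA v hv
    have h2 := hunit (((‖v‖⁻¹ : ℝ) : ℂ) • v) (by
      simp [norm_smul, hv'.ne'])
    rw [H.hom, norm_smul, norm_pow, Complex.norm_real, norm_inv, norm_norm,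
      Real.log_mul (by positivity) hFv.ne', Real.log_pow, Real.log_inv] at h2
    rw [norm_smul, hcn, Real.log_mul (inv_pos.2 hF0).ne' hFv.ne', Real.log_inv, ← hAd]
    have hd' : (2:ℝ) ≤ d := by exact_mod_cast hd
    have hp : 0 < 18 * Real.log 2 * (3:ℝ) ^ N := by positivity
    have : 18 * Real.log 2 * d * 3 ^ N ≤ 2 * (18 * Real.log 2 * 3 ^ N) * (d - 1) := by nlinarith
    rw [abs_le]
    constructor
    · linarith
    · have : 0 ≤ 2 * (18 * Real.log 2 * 3 ^ N) * ((d:ℝ) - 1) := by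
        apply mul_nonneg (by positivity); linarith
      linarith

lemma Good.comp {K : ℝ} (hK : 0 ≤ K) {h h' : CSphere → CSphere} (H : Good K h) (H' : Good K h') :
    Good K (h ∘ h') := by
  obtain ⟨F, d, hd, hF, hb⟩ := H
  obtain ⟨F', d', hd', hF', hb'⟩ := H'
  refine ⟨F ∘ F', d * d', by nlinarith, hF.comp hF', fun v hv => ?_⟩
  have h1 := hb (F' v) (hF'.ne v hv)
  have h2 := hb' v hv
  have dr : (0:ℝ) ≤ d := by positivity
  rw [abs_le] at h1 h2 ⊢
  have h3 := mul_le_mul_of_nonneg_left h2.1 dr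
  have h4 := mul_le_mul_of_nonneg_left h2.2 dr
  simp only [Function.comp]
  push_cast
  constructor <;> nlinarith

end UPJ
end UPJ

noncomputable section UPJ
open Set Metric Topology Filter MeasureTheory
open scoped UniformConvergence
namespace UPJ

lemma iter_ne {h : CSphere → CSphere} {F : ℂ × ℂ → ℂ × ℂ} {d : ℕ} (H : IsLift h F d) (n : ℕ)
    {v : ℂ × ℂ} (hv : v ≠ 0) : F^[n] v ≠ 0 ∧ h^[n] (pr v) = pr (F^[n] v) := by
  induction n with
  | zero => simpa using hv
  | succ n ih =>
    rw [Function.iterate_succ_apply', Function.iterate_succ_apply', ih.2]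
    exact ⟨H.ne _ ih.1, H.semi _ ih.1⟩

lemma iter_diff {F : ℂ × ℂ → ℂ × ℂ} (H : Differentiable ℂ F) (n : ℕ) :
    Differentiable ℂ (F^[n]) := by
  induction n with
  | zero => exact differentiable_id
  | succ n ih => rw [Function.iterate_succ']; exact H.comp ih

lemma green {K : ℝ} {h : CSphere → CSphere} {F : ℂ × ℂ → ℂ × ℂ} {d : ℕ} (hd : 2 ≤ d)
    (H : IsLift h F d)
    (hb : ∀ v, v ≠ 0 → |Real.log ‖F v‖ - d * Real.log ‖v‖| ≤ K * (d - 1)) :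
    ∃ γ : ℂ × ℂ → ℝ, ∀ v, v ≠ 0 → ∀ n : ℕ, |Real.log ‖F^[n] v‖ / (d:ℝ) ^ n - γ v| ≤ K / (d:ℝ) ^ n := by
  have hd' : (2:ℝ) ≤ d := by exact_mod_cast hd
  have key : ∀ v, ∃ g : ℝ, v ≠ 0 → ∀ n : ℕ, |Real.log ‖F^[n] v‖ / (d:ℝ) ^ n - g| ≤ K / (d:ℝ) ^ n := by
    intro v
    by_cases hv : v = 0
    · exact ⟨0, fun h => absurd hv h⟩
    set a : ℕ → ℝ := fun n => Real.log ‖F^[n] v‖ / (d:ℝ) ^ n with ha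
    have hstep : ∀ n, |a (n + 1) - a n| ≤ K / (d:ℝ) ^ n - K / (d:ℝ) ^ (n + 1) := by
      intro n
      have h1 := hb _ (iter_ne H n hv).1
      have e1 : a (n + 1) - a n = (Real.log ‖F (F^[n] v)‖ - d * Real.log ‖F^[n] v‖) / (d:ℝ) ^ (n + 1) := by
        simp only [ha, Function.iterate_succ_apply']
        field_simp
        ring
      have e2 : K / (d:ℝ) ^ n - K / (d:ℝ) ^ (n + 1) = K * (d - 1) / (d:ℝ) ^ (n + 1) := by
        field_simp
        ring
      rw [e1, e2, abs_div, abs_of_pos (by positivity : (0:ℝ) < (d:ℝ) ^ (n + 1))]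
      gcongr
    have htel : ∀ n k, |a (n + k) - a n| ≤ K / (d:ℝ) ^ n - K / (d:ℝ) ^ (n + k) := by
      intro n k
      induction k with
      | zero => simp
      | succ k ih =>
        have := hstep (n + k)
        have h3 := abs_sub_le (a (n + (k + 1))) (a (n + k)) (a n)
        rw [← add_assoc] at *
        linarith
    have hK : 0 ≤ K := by
      have := (abs_nonneg _).trans (hb v hv)
      nlinarith
    have hlim : Tendsto (fun n : ℕ => K / (d:ℝ) ^ n) atTop (𝓝 0) :=
      tendsto_const_nhds.div_atTop (tendsto_pow_atTop_atTop_of_one_lt (by linarith))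
    have hc : CauchySeq a := by
      refine cauchySeq_of_le_tendsto_0 (fun n => 2 * (K / (d:ℝ) ^ n)) ?_ (by simpa using hlim.const_mul 2)
      intro n m N hn hm
      obtain ⟨p, rfl⟩ := Nat.exists_eq_add_of_le hn
      obtain ⟨q, rfl⟩ := Nat.exists_eq_add_of_le hm
      have h1 := htel N p
      have h2 := htel N q
      have h3 := abs_sub_le (a (N + p)) (a N) (a (N + q))
      rw [abs_sub_comm (a N)] at h3
      rw [Real.dist_eq]
      have : 0 ≤ K / (d:ℝ) ^ (N + p) := by positivity
      have : 0 ≤ K / (d:ℝ) ^ (N + q) := by positivity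
      linarith
    obtain ⟨g, hg⟩ := cauchySeq_tendsto_of_complete hc
    refine ⟨g, fun _ n => ?_⟩
    have h1 : Tendsto (fun k => |a n - a (n + k)|) atTop (𝓝 |a n - g|) := by
      have : Tendsto (fun k => a (n + k)) atTop (𝓝 g) := by
        simpa [add_comm] using (tendsto_add_atTop_iff_nat n).2 hg
      exact (tendsto_const_nhds.sub this).abs
    refine le_of_tendsto' h1 fun k => ?_
    rw [abs_sub_comm]
    have : 0 ≤ K / (d:ℝ) ^ (n + k) := by positivity
    have := htel n k
    linarith
  choose γ hγ using key
  exact ⟨γ, hγ⟩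

lemma KL {K : ℝ} {θ : CSphere → CSphere} (hθ : Good K θ) {f : ℂ → ℂ × ℂ} {z₀ : ℂ} {ρ : ℝ}
    (hf : DifferentiableOn ℂ f (ball z₀ ρ)) (hf0 : ∀ ζ ∈ ball z₀ ρ, f ζ ≠ 0)
    (hn : ∀ ζ₀ ∈ ball z₀ ρ, ∃ σ > 0, ∀ ζ ∈ ball z₀ ρ, dist ζ ζ₀ < σ → ∀ n : ℕ,
      dist (θ^[n] (pr (f ζ))) (θ^[n] (pr (f ζ₀))) < 1 / 2) :
    ∀ ζ ∈ ball z₀ ρ, dist (pr (f ζ)) (pr (f z₀)) ≤ 12 * Real.exp (2 * K) * ‖ζ - z₀‖ / ρ := by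
  intro ζ hζ
  have hρ : 0 < ρ := dist_nonneg.trans_lt hζ
  obtain ⟨F, d, hd, H, hb⟩ := hθ
  have hd' : (2:ℝ) ≤ d := by exact_mod_cast hd
  obtain ⟨γ, hγ⟩ := green hd H hb
  have hharm : InnerProductSpace.HarmonicOnNhd (fun w => γ (f w)) (ball z₀ ρ) := by
    intro ζ₀ h0
    obtain ⟨σ, hσ, hcl⟩ := hn ζ₀ h0
    obtain ⟨τ, hτ, hsub⟩ := Metric.isOpen_iff.1 isOpen_ball ζ₀ h0
    set s := min σ τ with hs
    have hs0 : 0 < s := lt_min hσ hτ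
    have hsb : ∀ w ∈ ball ζ₀ s, w ∈ ball z₀ ρ := fun w hw =>
      hsub (ball_subset_ball (min_le_right _ _) hw)
    have hcl' : ∀ w ∈ ball ζ₀ s, ∀ n : ℕ, dist (pr (F^[n] (f w))) (pr (F^[n] (f ζ₀))) < 1 / 2 := by
      intro w hw n
      rw [← (iter_ne H n (hf0 w (hsb w hw))).2, ← (iter_ne H n (hf0 _ h0)).2]
      exact hcl w (hsb w hw) (lt_of_lt_of_le hw (min_le_left _ _)) n
    have hex : ∀ n : ℕ, ∃ g : ℂ → ℂ, DifferentiableOn ℂ g (ball ζ₀ s) ∧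
        (∀ w ∈ ball ζ₀ s, (g w).re = Real.log ‖al (F^[n] (f ζ₀)) (F^[n] (f w))‖) ∧
        (g ζ₀).im = 0 := by
      intro n
      apply exists_log
      · exact ((al_diff _).comp (iter_diff H.diff n)).comp_differentiableOn
          (hf.mono (fun w hw => hsb w hw))
      · intro w hw
        exact al_ne (iter_ne H n (hf0 _ h0)).1 (iter_ne H n (hf0 _ (hsb w hw))).1 (hcl' w hw n)
    choose g hg hre him using hex
    have hlim : Tendsto (fun n : ℕ => (K + Real.log 2) / (d:ℝ) ^ n) atTop (𝓝 0) :=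
      tendsto_const_nhds.div_atTop (tendsto_pow_atTop_atTop_of_one_lt (by linarith))
    refine harmonic_limit hs0 _ hlim
      (fun n w => ((((d:ℝ) ^ n)⁻¹ : ℝ) : ℂ) * (g n w - (Real.log ‖F^[n] (f ζ₀)‖ : ℝ))) ?_ ?_ ?_
    · intro n
      exact ((hg n).sub_const _).const_mul _
    · intro n
      rw [Complex.im_ofReal_mul]; simp [him]
    · intro n w hw
      have h1 := hγ _ (hf0 w (hsb w hw)) n
      have hne := (iter_ne H n (hf0 _ (hsb w hw))).1
      have hne0 := (iter_ne H n (hf0 _ h0)).1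
      have h2 := log_al_ge hne0 hne (hcl' w hw n)
      have h3 := log_al_le hne0 hne (al_ne hne0 hne (hcl' w hw n))
      simp only [Complex.re_ofReal_mul, Complex.sub_re, Complex.ofReal_re, hre n w hw]
      have hp : (0:ℝ) < (d:ℝ) ^ n := by positivity
      set A := Real.log ‖al (F^[n] (f ζ₀)) (F^[n] (f w))‖
      set B := Real.log ‖F^[n] (f ζ₀)‖
      set C := Real.log ‖F^[n] (f w)‖
      have e : ((d:ℝ) ^ n)⁻¹ * (A - B) - γ (f w) = (A - B - C) / (d:ℝ) ^ n + (C / (d:ℝ) ^ n - γ (f w)) := by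
        field_simp; ring
      rw [e, add_div, add_comm (K / (d:ℝ) ^ n)]
      refine (abs_add_le _ _).trans (add_le_add ?_ h1)
      rw [abs_div, abs_of_pos hp]
      gcongr
      rw [abs_le]; constructor <;> linarith
  obtain ⟨g, hg, hgre⟩ := InnerProductSpace.HarmonicOnNhd.exists_analyticOnNhd_ball_re_eq hharm
  have hbd : ∀ w ∈ ball z₀ ρ, |Real.log ‖f w‖ - (g w).re| ≤ K := by
    intro w hw
    have h1 := hγ _ (hf0 w hw) 0
    have h2 := hgre hw
    simp at h1 h2
    rw [h2]; exact h1
  set k : ℂ → ℂ × ℂ := fun w => Complex.exp (- g w) • f w with hk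
  have hkd : DifferentiableOn ℂ k (ball z₀ ρ) :=
    (hg.differentiableOn.neg.cexp).smul hf
  have hkn : ∀ w ∈ ball z₀ ρ, ‖k w‖ ≤ Real.exp K ∧ Real.exp (-K) ≤ ‖k w‖ := by
    intro w hw
    have hp := norm_pos_iff.2 (hf0 w hw)
    have h1 := abs_le.1 (hbd w hw)
    have e : ‖k w‖ = Real.exp (Real.log ‖f w‖ - (g w).re) := by
      rw [hk, norm_smul, Complex.norm_exp, Complex.neg_re, sub_eq_add_neg, Real.exp_add, Real.exp_log hp,
        mul_comm]
    rw [e]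
    constructor <;> apply Real.exp_le_exp.2 <;> linarith
  have hkpr : ∀ w, pr (k w) = pr (f w) := fun w => pr_smul (Complex.exp_ne_zero _) _
  have hz0 : z₀ ∈ ball z₀ ρ := mem_ball_self hρ
  have hE := Real.exp_pos K
  have hS := Complex.dist_le_div_mul_dist_of_mapsTo_ball (R₂ := 3 * Real.exp K) hkd (by
    intro w hw
    rw [mem_closedBall, dist_eq_norm]
    have := norm_sub_le (k w) (k z₀)
    have := (hkn w hw).1
    have := (hkn z₀ hz0).1
    linarith) hζ
  have hk0 : k z₀ ≠ 0 := by
    rw [← norm_pos_iff]; exact (Real.exp_pos _).trans_le (hkn z₀ hz0).2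
  have hk1 : k ζ ≠ 0 := by
    rw [← norm_pos_iff]; exact (Real.exp_pos _).trans_le (hkn ζ hζ).2
  rw [← hkpr, ← hkpr z₀, dist_comm]
  refine (dist_pr_le hk0 hk1).trans ?_
  rw [dist_eq_norm, dist_eq_norm] at hS
  rw [norm_sub_rev]
  calc 4 * ‖k ζ - k z₀‖ / ‖k z₀‖ ≤ 4 * (3 * Real.exp K / ρ * ‖ζ - z₀‖) / Real.exp (-K) := by
        gcongr
        exact (hkn z₀ hz0).2
    _ = _ := by
        rw [Real.exp_neg, show 2 * K = K + K by ring, Real.exp_add]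
        field_simp; ring

end UPJ
end UPJ

noncomputable section UPJ
open Set Metric Topology Filter MeasureTheory
open scoped UniformConvergence
namespace UPJ

/-- chart lift -/
def Tt (u : ℂ × ℂ) (z : ℂ) : ℂ × ℂ :=
  u + z • ((-(starRingEnd ℂ) u.2, (starRingEnd ℂ) u.1) : ℂ × ℂ)

lemma Tt_diff (u : ℂ × ℂ) : Differentiable ℂ (Tt u) := by
  unfold Tt; fun_prop

lemma nn_c {u : ℂ × ℂ} (hu : nn u = 1) :
    u.1 * (starRingEnd ℂ) u.1 + u.2 * (starRingEnd ℂ) u.2 = 1 := by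
  unfold nn at hu
  rw [Complex.mul_conj, Complex.mul_conj, Complex.normSq_eq_norm_sq, Complex.normSq_eq_norm_sq]
  exact_mod_cast hu

lemma wg_Tt {u : ℂ × ℂ} (hu : nn u = 1) (z : ℂ) : wg u (Tt u z) = z := by
  have := nn_c hu
  simp only [wg, Tt, Prod.fst_add, Prod.snd_add, Prod.smul_fst, Prod.smul_snd, smul_eq_mul]
  linear_combination z * this

lemma al_Tt {u : ℂ × ℂ} (hu : nn u = 1) (z : ℂ) : al u (Tt u z) = 1 := by
  have := nn_c hu
  simp only [al, Tt, Prod.fst_add, Prod.snd_add, Prod.smul_fst, Prod.smul_snd, smul_eq_mul]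
  linear_combination this

lemma nn_Tt {u : ℂ × ℂ} (hu : nn u = 1) (z : ℂ) : nn (Tt u z) = 1 + ‖z‖ ^ 2 := by
  have := al_wg u (Tt u z)
  rw [wg_Tt hu, al_Tt hu, hu] at this
  simp at this; linarith

lemma Tt_ne {u : ℂ × ℂ} (hu : nn u = 1) (z : ℂ) : Tt u z ≠ 0 := by
  intro h
  have := al_Tt hu z
  rw [h] at this
  simp [al] at this

lemma ne_of_nn {u : ℂ × ℂ} (hu : nn u = 1) : u ≠ 0 := by
  rintro rfl
  simp [nn] at hu

lemma Tt_zero (u : ℂ × ℂ) : Tt u 0 = u := by simp [Tt]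

lemma wg_Tt2 {u : ℂ × ℂ} (hu : nn u = 1) (z z' : ℂ) : wg (Tt u z) (Tt u z') = z' - z := by
  have := wg_al u (Tt u z) (Tt u z')
  rw [hu, al_Tt hu, al_Tt hu, wg_Tt hu, wg_Tt hu] at this
  simpa using this

lemma T_lip {u : ℂ × ℂ} (hu : nn u = 1) (z z' : ℂ) :
    dist (pr (Tt u z)) (pr (Tt u z')) ≤ 2 * ‖z - z'‖ := by
  have h := dist_sq_le (Tt_ne hu z) (Tt_ne hu z')
  rw [nn_Tt hu, nn_Tt hu, wg_Tt2 hu, norm_sub_rev] at h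
  refine le_of_sq_le_sq (h.trans ?_) (by positivity)
  rw [div_le_iff₀ (by positivity)]
  have : 1 ≤ (1 + ‖z‖ ^ 2) * (1 + ‖z'‖ ^ 2) := by nlinarith [sq_nonneg ‖z‖, sq_nonneg ‖z'‖, mul_nonneg (sq_nonneg ‖z‖) (sq_nonneg ‖z'‖)]
  nlinarith [sq_nonneg ‖z - z'‖]

lemma T_colip {u : ℂ × ℂ} (hu : nn u = 1) {z z' : ℂ} (hz : ‖z‖ ≤ 1) (hz' : ‖z'‖ ≤ 1) :
    ‖z - z'‖ ≤ 2 * dist (pr (Tt u z)) (pr (Tt u z')) := by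
  have h := dist_sq_ge (Tt_ne hu z) (Tt_ne hu z')
  rw [nn_Tt hu, nn_Tt hu, wg_Tt2 hu, norm_sub_rev] at h
  refine le_of_sq_le_sq ?_ (by positivity)
  rw [div_le_iff₀ (by positivity)] at h
  have a : 1 + ‖z‖ ^ 2 ≤ 2 := by nlinarith [norm_nonneg z]
  have a' : 1 + ‖z'‖ ^ 2 ≤ 2 := by nlinarith [norm_nonneg z']
  have : (1 + ‖z‖ ^ 2) * (1 + ‖z'‖ ^ 2) ≤ 4 := by nlinarith [sq_nonneg ‖z‖, sq_nonneg ‖z'‖]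
  nlinarith [sq_nonneg (dist (pr (Tt u z)) (pr (Tt u z')))]

lemma T_lower {u : ℂ × ℂ} (hu : nn u = 1) {z : ℂ} (hz : ‖z‖ ≤ 1) :
    ‖z‖ ≤ dist (pr u) (pr (Tt u z)) := by
  have h := dist_sq_ge (ne_of_nn hu) (Tt_ne hu z)
  rw [nn_Tt hu, wg_Tt hu, hu] at h
  refine le_of_sq_le_sq ?_ (by positivity)
  rw [div_le_iff₀ (by positivity)] at h
  have a : 1 + ‖z‖ ^ 2 ≤ 2 := by nlinarith [norm_nonneg z]
  nlinarith [sq_nonneg (dist (pr u) (pr (Tt u z)))]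

lemma T_upper {u : ℂ × ℂ} (hu : nn u = 1) (z : ℂ) :
    dist (pr u) (pr (Tt u z)) ≤ 2 * ‖z‖ := by
  have := T_lip hu 0 z
  rwa [Tt_zero, zero_sub, norm_neg] at this

lemma Tt_dec {u : ℂ × ℂ} (hu : nn u = 1) {v : ℂ × ℂ} (ha : al u v ≠ 0) :
    pr (Tt u (wg u v / al u v)) = pr v := by
  rw [← pr_smul ha (Tt u _)]
  congr 1
  have := nn_c hu
  ext
  · simp only [Tt, Prod.fst_add, Prod.smul_fst, smul_eq_mul]
    rw [mul_add, ← mul_assoc, mul_div_cancel₀ _ ha]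
    simp only [al, wg]
    linear_combination v.1 * this
  · simp only [Tt, Prod.snd_add, Prod.smul_snd, smul_eq_mul]
    rw [mul_add, ← mul_assoc, mul_div_cancel₀ _ ha]
    simp only [al, wg]
    linear_combination v.2 * this

lemma T_surj {u : ℂ × ℂ} (hu : nn u = 1) {w : CSphere} (hw : dist (pr u) w < 1) :
    ∃ z, ‖z‖ ≤ dist (pr u) w ∧ pr (Tt u z) = w := by
  obtain ⟨v, hv, hv1, rfl⟩ := pr_surj w
  have h := dist_sq_ge (ne_of_nn hu) hv
  have h2 := al_wg u v
  rw [hu, hv1] at h h2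
  have h3 : dist (pr u) (pr v) ^ 2 < 1 := by
    have := dist_nonneg (x := pr u) (y := pr v)
    nlinarith
  simp at h h2
  have ha : al u v ≠ 0 := by
    intro h0
    rw [h0, norm_zero] at h2
    linarith
  have hap := norm_pos_iff.2 ha
  have hq : ‖wg u v / al u v‖ ≤ 1 := by
    rw [norm_div, div_le_one hap]
    refine le_of_sq_le_sq ?_ hap.le
    linarith
  refine ⟨wg u v / al u v, ?_, Tt_dec hu ha⟩
  have := T_lower hu hq
  rwa [Tt_dec hu ha] at this

lemma dist_le_two (x y : CSphere) : dist x y ≤ 2 := by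
  obtain ⟨v, hv, hv1, rfl⟩ := pr_surj x
  obtain ⟨w, hw, hw1, rfl⟩ := pr_surj y
  have h := dist_sq_le hv hw
  have h2 := al_wg v w
  rw [hv1, hw1] at h h2
  simp at h
  refine le_of_sq_le_sq ?_ (by norm_num)
  nlinarith [sq_nonneg ‖al v w‖]

lemma Ch {H : Set (CSphere → CSphere)} (hH : ∀ g ∈ H, ∃ F d, IsLift g F d) {z : CSphere} {r : ℝ}
    (hr : 0 < r) (hs : ∀ g ∈ H, ∀ x ∈ ball z r, dist (g x) (g z) < 1 / 2) : z ∈ rsFatou H := by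
  obtain ⟨u, hu0, hu, rfl⟩ := pr_surj z
  wlog hr1 : r ≤ 1 generalizing r
  · exact this one_pos (fun g hg x hx => hs g hg x (ball_subset_ball (by linarith) hx)) le_rfl
  refine ⟨r / 8, by positivity, fun ε hε => ⟨ε * r / 17, by positivity, ?_⟩⟩
  intro g hg w₁ h1 w₂ h2 hd
  rw [mem_ball, dist_comm] at h1 h2
  obtain ⟨a, ha, rfl⟩ := T_surj hu (w := w₁) (by linarith)
  obtain ⟨b, hb, rfl⟩ := T_surj hu (w := w₂) (by linarith)
  have hab := T_colip hu (z := a) (z' := b) (by linarith) (by linarith)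
  obtain ⟨F, d, hF⟩ := hH g hg
  set U := F u
  have hU : U ≠ 0 := hF.ne _ hu0
  have hne : ∀ ζ, F (Tt u ζ) ≠ 0 := fun ζ => hF.ne _ (Tt_ne hu ζ)
  have hcl : ∀ ζ ∈ ball (0:ℂ) (r / 2), dist (pr (F (Tt u ζ))) (pr U) < 1 / 2 := by
    intro ζ hζ
    rw [← hF.semi _ (Tt_ne hu ζ), ← hF.semi _ hu0]
    apply hs g hg
    rw [mem_ball, dist_comm]
    have := T_upper hu ζ
    have : ‖ζ‖ < r / 2 := by simpa using hζ
    linarith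
  set q : ℂ → ℂ := fun ζ => wg U (F (Tt u ζ)) / al U (F (Tt u ζ)) with hq
  have halne : ∀ ζ ∈ ball (0:ℂ) (r / 2), al U (F (Tt u ζ)) ≠ 0 := fun ζ hζ =>
    al_ne hU (hne ζ) (hcl ζ hζ)
  have hFd : Differentiable ℂ fun ζ => F (Tt u ζ) := hF.diff.comp (Tt_diff u)
  have hqd : DifferentiableOn ℂ q (ball 0 (r / 2)) :=
    ((wg_diff U).comp hFd).differentiableOn.div ((al_diff U).comp hFd).differentiableOn halne
  have hqb : ∀ ζ ∈ ball (0:ℂ) (r / 2), ‖q ζ‖ < 1 / 2 := fun ζ hζ =>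
    (q_le_dist hU (hne ζ) (hcl ζ hζ)).trans_lt (hcl ζ hζ)
  have hsub : ball b (r / 4) ⊆ ball (0:ℂ) (r / 2) := by
    apply ball_subset_ball'
    rw [dist_zero_right]; linarith
  have hmb : b ∈ ball (0:ℂ) (r / 2) := hsub (mem_ball_self (by positivity))
  have hma' : a ∈ ball b (r / 4) := by
    rw [mem_ball, dist_eq_norm]
    have := norm_sub_le a b
    linarith
  have hma := hsub hma'
  have hS := Complex.dist_le_div_mul_dist_of_mapsTo_ball (R₂ := 1) (hqd.mono hsub) (by
    intro w hw
    rw [mem_closedBall, dist_eq_norm]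
    have := norm_sub_le (q w) (q b)
    have := hqb w (hsub hw)
    have := hqb b hmb
    linarith) hma'
  have hD := dist_le_q hU (hne a) (hne b) (halne a hma) (halne b hmb)
  rw [← hF.semi _ (Tt_ne hu a), ← hF.semi _ (Tt_ne hu b)] at hD
  rw [dist_eq_norm, dist_eq_norm] at hS
  have e : (1:ℝ) / (r / 4) = 4 / r := by field_simp
  rw [e] at hS
  have : 4 / r * ‖a - b‖ ≤ 4 / r * (2 * (ε * r / 17)) := by
    gcongr; linarith
  have e2 : 4 / r * (2 * (ε * r / 17)) = 8 / 17 * ε := by field_simp; ring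
  rw [e2] at this
  simp only [hq] at hS
  linarith

lemma fatou_open (H : Set (CSphere → CSphere)) : IsOpen (rsFatou H) := by
  rw [Metric.isOpen_iff]
  rintro z ⟨r, hr, h⟩
  refine ⟨r, hr, fun w hw => ⟨r - dist w z, by simpa using hw, fun ε hε => ?_⟩⟩
  obtain ⟨δ, hδ, h⟩ := h ε hε
  have hsub : ball w (r - dist w z) ⊆ ball z r := ball_subset_ball' (by linarith)
  exact ⟨δ, hδ, fun g hg a ha b hb hab => h g hg a (hsub ha) b (hsub hb) hab⟩

instance : CompactSpace CSphere := by
  constructor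
  have hS : IsCompact {v : ℂ × ℂ | nn v = 1} := by
    apply Metric.isCompact_of_isClosed_isBounded
    · apply isClosed_eq _ continuous_const
      unfold nn; fun_prop
    · rw [Metric.isBounded_iff_subset_closedBall 0]
      refine ⟨1, fun v hv => ?_⟩
      have := nn_ge v
      rw [mem_ofPred_eq] at hv
      rw [mem_closedBall_zero_iff]
      nlinarith [norm_nonneg v]
  have : (univ : Set CSphere) = pr '' {v : ℂ × ℂ | nn v = 1} := by
    ext z
    simp only [mem_univ, true_iff]
    obtain ⟨v, _, h1, h2⟩ := pr_surj z
    exact ⟨v, h1, h2⟩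
  rw [this]
  apply hS.image_of_continuousOn
  intro v hv
  have hv0 : v ≠ 0 := ne_of_nn hv
  have hvp := norm_pos_iff.2 hv0
  rw [Metric.continuousWithinAt_iff]
  intro ε hε
  refine ⟨ε * ‖v‖ / 5, by positivity, fun {w} hw hd => ?_⟩
  rw [dist_comm]
  refine (dist_pr_le hv0 (ne_of_nn hw)).trans_lt ?_
  rw [div_lt_iff₀ hvp, norm_sub_rev, ← dist_eq_norm]
  nlinarith [mul_pos hε hvp]

lemma equi (Λ : Set (CSphere →ᵤ CSphere)) (hcpt : IsCompact Λ)
    (hc : ∀ φ ∈ Λ, Continuous (UniformFun.toFun φ)) {ε : ℝ} (hε : 0 < ε) :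
    ∃ δ > 0, ∀ h ∈ UniformFun.toFun '' Λ, ∀ x y, dist x y < δ → dist (h x) (h y) < ε := by
  have hU := (UniformFun.hasBasis_uniformity CSphere CSphere).mem_of_mem
    (Metric.dist_mem_uniformity (α := CSphere) (ε := ε / 3) (by positivity))
  obtain ⟨t, hts, htf, hcov⟩ := hcpt.totallyBounded.exists_subset hU
  have key : ∃ δ > 0, ∀ φ ∈ t, ∀ x y, dist x y < δ →
      dist (UniformFun.toFun φ x) (UniformFun.toFun φ y) < ε / 3 := by
    clear hcov
    induction t, htf using Set.Finite.induction_on with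
    | empty => exact ⟨1, one_pos, by simp⟩
    | insert _ _ ih =>
      rename_i φ s _ _
      obtain ⟨δ, hδ, h⟩ := ih (fun x hx => hts (mem_insert_of_mem _ hx))
      have hu := CompactSpace.uniformContinuous_of_continuous (hc φ (hts (mem_insert _ _)))
      obtain ⟨δ', hδ', h'⟩ := Metric.uniformContinuous_iff.1 hu (ε / 3) (by positivity)
      refine ⟨min δ δ', lt_min hδ hδ', ?_⟩
      rintro ψ (rfl | hψ) x y hxy
      · exact h' (hxy.trans_le (min_le_right _ _))
      · exact h ψ hψ x y (hxy.trans_le (min_le_left _ _))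
  obtain ⟨δ, hδ, hk⟩ := key
  refine ⟨δ, hδ, ?_⟩
  rintro _ ⟨φ, hφ, rfl⟩ x y hxy
  have := hcov hφ
  simp only [mem_iUnion] at this
  obtain ⟨ψ, hψ, hm⟩ := this
  have hm' : ∀ x, dist (UniformFun.toFun φ x) (UniformFun.toFun ψ x) < ε / 3 := fun x => hm x
  have h1 := hm' x
  have h2 := hm' y
  have h3 := hk ψ hψ x y hxy
  rw [dist_comm] at h2
  have := dist_triangle4 (UniformFun.toFun φ x) (UniformFun.toFun ψ x) (UniformFun.toFun ψ y) (UniformFun.toFun φ y)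
  linarith

end UPJ
end UPJ

noncomputable section UPJ
open Set Metric Topology Filter MeasureTheory
open scoped UniformConvergence
namespace UPJ

lemma id_lift : IsLift id id 1 where
  diff := differentiable_id
  ne := fun v hv => hv
  hom := fun c v => by simp
  semi := fun v hv => rfl

def wd (l : List (CSphere → CSphere)) : CSphere → CSphere := l.foldr (· ∘ ·) id

lemma wd_append (l₁ l₂ : List (CSphere → CSphere)) : wd (l₁ ++ l₂) = wd l₁ ∘ wd l₂ := by
  induction l₁ with
  | nil => rfl
  | cons a l ih =>
    have : wd (a :: l ++ l₂) = a ∘ wd (l ++ l₂) := rfl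
    rw [this, ih]; rfl

lemma wd_good {K : ℝ} (hK : 0 ≤ K) {S : Set (CSphere → CSphere)} (hS : ∀ h ∈ S, Good K h)
    (l : List (CSphere → CSphere)) (hl : ∀ a ∈ l, a ∈ S) (h0 : l ≠ []) : Good K (wd l) := by
  induction l with
  | nil => exact absurd rfl h0
  | cons a l ih =>
    rcases eq_or_ne l [] with rfl | h
    · exact hS a (hl a (by simp))
    · change Good K (a ∘ wd l)
      exact Good.comp hK (hS a (hl a (by simp))) (ih (fun b hb => hl b (by simp [hb])) h)

lemma wd_lift {K : ℝ} {S : Set (CSphere → CSphere)} (hS : ∀ h ∈ S, Good K h)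
    (l : List (CSphere → CSphere)) (hl : ∀ a ∈ l, a ∈ S) : ∃ F d, IsLift (wd l) F d := by
  induction l with
  | nil => exact ⟨id, 1, id_lift⟩
  | cons a l ih =>
    obtain ⟨F, d, hF⟩ := ih (fun b hb => hl b (by simp [hb]))
    obtain ⟨F', d', _, hF', _⟩ := hS a (hl a (by simp))
    exact ⟨_, _, hF'.comp hF⟩

lemma iter_mem {H : Set (CSphere → CSphere)} (hcomp : ∀ a ∈ H, ∀ b ∈ H, a ∘ b ∈ H)
    {h : CSphere → CSphere} (hh : h ∈ H) (n : ℕ) : h^[n + 1] ∈ H := by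
  induction n with
  | zero => simpa using hh
  | succ n ih => rw [Function.iterate_succ]; exact hcomp _ ih _ hh

lemma KLH {K : ℝ} {H : Set (CSphere → CSphere)} (hcomp : ∀ a ∈ H, ∀ b ∈ H, a ∘ b ∈ H)
    {ψ φ : CSphere → CSphere} (hθ : Good K (ψ ∘ φ)) (hψ : ∃ F d, IsLift ψ F d) (hh : φ ∘ ψ ∈ H)
    {f : ℂ → ℂ × ℂ} {z₀ : ℂ} {ρ : ℝ}
    (hf : DifferentiableOn ℂ f (ball z₀ ρ)) (hf0 : ∀ ζ ∈ ball z₀ ρ, f ζ ≠ 0)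
    (hF : ∀ ζ ∈ ball z₀ ρ, pr (f ζ) ∈ rsFatou H) :
    ∀ ζ ∈ ball z₀ ρ, dist (ψ (pr (f ζ))) (ψ (pr (f z₀))) ≤ 12 * Real.exp (2 * K) * ‖ζ - z₀‖ / ρ := by
  intro ζ hζ
  have hρ : 0 < ρ := dist_nonneg.trans_lt hζ
  obtain ⟨F, d, hL⟩ := hψ
  have hz0 : z₀ ∈ ball z₀ ρ := mem_ball_self hρ
  rw [hL.semi _ (hf0 _ hζ), hL.semi _ (hf0 _ hz0)]
  refine KL hθ (f := fun ζ => F (f ζ)) (hL.diff.comp_differentiableOn hf)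
    (fun w hw => hL.ne _ (hf0 w hw)) ?_ ζ hζ
  intro w hw
  obtain ⟨r, hr, hfat⟩ := hF w hw
  have hu := CompactSpace.uniformContinuous_of_continuous hL.continuous
  obtain ⟨η, hη, huc⟩ := Metric.uniformContinuous_iff.1 hu (1 / 2) (by positivity)
  obtain ⟨δ, hδ, hfat⟩ := hfat η hη
  have hfc : ContinuousAt f w := (hf.differentiableAt (isOpen_ball.mem_nhds hw)).continuousAt
  have hwn := norm_pos_iff.2 (hf0 w hw)
  obtain ⟨σ, hσ, hσf⟩ := Metric.continuousAt_iff.1 hfc (min r (min δ η) * ‖f w‖ / 5) (by positivity)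
  refine ⟨σ, hσ, fun x hx hxw n => ?_⟩
  have hd1 : dist (pr (f x)) (pr (f w)) < min r (min δ η) := by
    rw [dist_comm]
    refine (dist_pr_le (hf0 w hw) (hf0 x hx)).trans_lt ?_
    have := hσf hxw
    rw [dist_eq_norm] at this
    rw [div_lt_iff₀ hwn, norm_sub_rev]
    have : 0 < min r (min δ η) * ‖f w‖ := by positivity
    linarith
  have hsc : Function.Semiconj ψ (φ ∘ ψ) (ψ ∘ φ) := fun _ => rfl
  have hit : ∀ y, (ψ ∘ φ)^[n] (ψ y) = ψ ((φ ∘ ψ)^[n] y) := fun y =>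
    ((hsc.iterate_right n) y).symm
  rw [← hL.semi _ (hf0 _ hx), ← hL.semi _ (hf0 _ hw), hit, hit]
  apply huc
  cases n with
  | zero => exact hd1.trans_le ((min_le_right _ _).trans (min_le_right _ _))
  | succ n =>
    exact hfat _ (iter_mem hcomp hh n) _ (hd1.trans_le (min_le_left _ _)) _ (mem_ball_self hr)
      (hd1.trans_le ((min_le_right _ _).trans (min_le_left _ _)))

lemma MP {ψ : CSphere → CSphere} {F : ℂ × ℂ → ℂ × ℂ} {d : ℕ} (hF : IsLift ψ F d) {u : ℂ × ℂ}
    (hu : nn u = 1) {s : ℝ} (hs : 0 < s) {e : ℝ}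
    (h1 : ∀ z : ℂ, ‖z‖ ≤ s → dist (ψ (pr (Tt u z))) (ψ (pr (Tt u s))) < 1 / 2)
    (h2 : ∀ z : ℂ, ‖z‖ = s → dist (ψ (pr (Tt u z))) (ψ (pr (Tt u s))) ≤ e) :
    ∀ z : ℂ, ‖z‖ ≤ s → dist (ψ (pr (Tt u z))) (ψ (pr (Tt u s))) ≤ 2 * e := by
  set U := F (Tt u s) with hUd
  have hU : U ≠ 0 := hF.ne _ (Tt_ne hu _)
  have hne : ∀ ζ, F (Tt u ζ) ≠ 0 := fun ζ => hF.ne _ (Tt_ne hu ζ)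
  have hsm : ∀ ζ, ψ (pr (Tt u ζ)) = pr (F (Tt u ζ)) := fun ζ => hF.semi _ (Tt_ne hu ζ)
  simp only [hsm] at *
  rw [← hUd] at *
  have halne : ∀ ζ : ℂ, ‖ζ‖ ≤ s → al U (F (Tt u ζ)) ≠ 0 := fun ζ hζ =>
    al_ne hU (hne ζ) (h1 ζ hζ)
  have hFd : Differentiable ℂ fun ζ => F (Tt u ζ) := hF.diff.comp (Tt_diff u)
  set q : ℂ → ℂ := fun ζ => wg U (F (Tt u ζ)) / al U (F (Tt u ζ)) with hq
  have hqd : DifferentiableOn ℂ q (closure (ball 0 s)) := by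
    refine ((wg_diff U).comp hFd).differentiableOn.div ((al_diff U).comp hFd).differentiableOn ?_
    intro x hx
    rw [closure_ball _ hs.ne'] at hx
    exact halne x (by simpa using hx)
  intro z hz
  have hqz : ‖q z‖ ≤ e := by
    refine Complex.norm_le_of_forall_mem_frontier_norm_le isBounded_ball hqd.diffContOnCl ?_
      (z := z) (by rw [closure_ball _ hs.ne']; simpa using hz)
    intro x hx
    rw [frontier_ball _ hs.ne'] at hx
    have hx' : ‖x‖ = s := by simpa using hx
    exact (q_le_dist hU (hne x) (h1 x hx'.le)).trans (h2 x hx')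
  have := dist_le_q hU (hne z) hU (halne z hz) (by
    apply halne s; simp [abs_of_pos hs])
  have e0 : wg U U = 0 := by unfold wg; ring
  rw [e0, zero_div, sub_zero] at this
  linarith

lemma suffix {K c : ℝ} (hK : 0 ≤ K) {S H : Set (CSphere → CSphere)} (hS : ∀ h ∈ S, Good K h)
    (hc : 0 < c) (hc1 : c ≤ 1 / 4)
    (heq : ∀ h ∈ S, ∀ x y, dist x y < c → dist (h x) (h y) < 1 / 2)
    (hcomp : ∀ a ∈ H, ∀ b ∈ H, a ∘ b ∈ H) {u : ℂ × ℂ} (hu : nn u = 1) {s ρ : ℝ}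
    (hs : 0 < s) (hsc : 4 * s < c) (hρ : 24 * Real.exp (2 * K) * Real.pi < c * ρ)
    (hF : ∀ ζ ∈ ball (Real.log s : ℂ) ρ, pr (Tt u (Complex.exp ζ)) ∈ rsFatou H)
    (l₁ l₂ : List (CSphere → CSphere)) (hl₁ : ∀ a ∈ l₁, a ∈ S) (hl₂ : ∀ a ∈ l₂, a ∈ S)
    (hH : wd (l₁ ++ l₂) ∈ H) :
    ∀ z : ℂ, ‖z‖ ≤ s → dist (wd l₂ (pr (Tt u z))) (wd l₂ (pr (Tt u s))) < c := by
  induction l₂ generalizing l₁ with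
  | nil =>
    intro z hz
    refine lt_of_le_of_lt ?_ hsc
    refine (T_lip hu z s).trans ?_
    have := norm_sub_le z s
    rw [Complex.norm_real, Real.norm_eq_abs, abs_of_pos hs] at this
    linarith
  | cons g l ih =>
    have ih := ih (l₁ ++ [g]) (by
      intro a ha
      rcases List.mem_append.1 ha with h | h
      · exact hl₁ a h
      · simp at h; exact h ▸ hl₂ g (by simp)) (fun a ha => hl₂ a (by simp [ha])) (by simpa using hH)
    obtain ⟨F, d, hL⟩ := wd_lift hS (g :: l) hl₂
    have hcρ : 0 < c * ρ := lt_of_le_of_lt (by positivity) hρ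
    have hρ0 : 0 < ρ := (mul_pos_iff_of_pos_left hc).1 hcρ
    have hE : 1 ≤ Real.exp (2 * K) := Real.one_le_exp (by positivity)
    have hpi := Real.pi_pos
    have hπρ : Real.pi < ρ := by nlinarith
    have key : ∀ z : ℂ, ‖z‖ ≤ s → dist (wd (g :: l) (pr (Tt u z))) (wd (g :: l) (pr (Tt u s))) ≤
        2 * (12 * Real.exp (2 * K) * Real.pi / ρ) := by
      apply MP hL hu hs
      · intro z hz
        exact heq g (hl₂ g (by simp)) _ _ (ih z hz)
      · intro z hz
        have hgood : Good K (wd (g :: l) ∘ wd l₁) := by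
          rw [← wd_append]
          apply wd_good hK hS
          · intro a ha
            rcases List.mem_append.1 ha with h | h
            · exact hl₂ a h
            · exact hl₁ a h
          · simp
        have hz0 : z ≠ 0 := by rw [← norm_pos_iff, hz]; exact hs
        have hsub : Complex.log z - (Real.log s : ℂ) = Complex.arg z * Complex.I := by
          apply Complex.ext
          · simp [Complex.log_re, hz]
          · simp [Complex.log_im]
        have hn : ‖Complex.log z - (Real.log s : ℂ)‖ ≤ Real.pi := by
          rw [hsub]; simpa using Complex.abs_arg_le_pi z
        have := KLH hcomp hgood ⟨F, d, hL⟩ (by rw [← wd_append]; exact hH)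
          (f := fun ζ => Tt u (Complex.exp ζ)) (z₀ := (Real.log s : ℂ)) (ρ := ρ)
          (((Tt_diff u).comp Complex.differentiable_exp).differentiableOn)
          (fun ζ _ => Tt_ne hu _) hF (Complex.log z) (by
            rw [mem_ball, dist_eq_norm]; linarith)
        rw [Complex.exp_log hz0, ← Complex.ofReal_exp, Real.exp_log hs] at this
        refine this.trans ?_
        gcongr
    intro z hz
    refine (key z hz).trans_lt ?_
    rw [← mul_div_assoc, div_lt_iff₀ hρ0]
    linarith

lemma nontriv {K : ℝ} {H : Set (CSphere → CSphere)} (hcomp : ∀ a ∈ H, ∀ b ∈ H, a ∘ b ∈ H)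
    {h : CSphere → CSphere} (hh : h ∈ H) (hg : Good K h) : (rsJulia H).Nontrivial := by
  by_contra hcon
  rw [not_nontrivial_iff] at hcon
  have : ∃ b, rsJulia H ⊆ {b} := by
    rcases hcon.eq_empty_or_singleton with h | ⟨b, h⟩
    · exact ⟨CSphere.infty, by rw [h]; exact empty_subset _⟩
    · exact ⟨b, h.subset⟩
  obtain ⟨b, hb⟩ := this
  obtain ⟨v, hv0, hv, rfl⟩ := pr_surj b
  have hnc := nn_c hv
  set f : ℂ → ℂ × ℂ := fun ζ => ((-(starRingEnd ℂ) v.2, (starRingEnd ℂ) v.1) : ℂ × ℂ) + ζ • v with hf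
  have hw : ∀ ζ, wg v (f ζ) = 1 := by
    intro ζ
    simp only [hf, wg, Prod.fst_add, Prod.snd_add, Prod.smul_fst, Prod.smul_snd, smul_eq_mul]
    linear_combination hnc
  have hf0 : ∀ ζ, f ζ ≠ 0 := by
    intro ζ h0
    have := hw ζ
    rw [h0] at this
    simp [wg] at this
  have sep : ∀ v w : ℂ × ℂ, v ≠ 0 → w ≠ 0 → wg v w ≠ 0 → 0 < dist (pr v) (pr w) := by
    intro v w hv hw h
    have h1 := dist_sq_ge hv hw
    have h2 := nn_pos hv
    have h3 := nn_pos hw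
    have h4 : 0 < 2 * ‖wg v w‖ ^ 2 / (nn v * nn w) := by positivity
    by_contra h5
    have : dist (pr v) (pr w) = 0 := le_antisymm (not_lt.1 h5) dist_nonneg
    rw [this] at h1
    norm_num at h1
    linarith
  have hfat : ∀ ζ, pr (f ζ) ∈ rsFatou H := by
    intro ζ
    by_contra hn
    have h1 : pr (f ζ) = pr v := hb hn
    have := sep v (f ζ) hv0 (hf0 ζ) (by rw [hw]; exact one_ne_zero)
    rw [h1, dist_self] at this
    exact lt_irrefl _ this
  have hD := sep (f 1) (f 0) (hf0 1) (hf0 0) (by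
    have : wg (f 1) (f 0) = 1 := by
      simp only [hf, wg, Prod.fst_add, Prod.snd_add, Prod.smul_fst, Prod.smul_snd, smul_eq_mul]
      linear_combination hnc
    rw [this]; exact one_ne_zero)
  set D := dist (pr (f 1)) (pr (f 0))
  have hE := Real.exp_pos (2 * K)
  have := KLH (ψ := id) (φ := h) (K := K) hcomp hg ⟨id, 1, id_lift⟩ hh (f := f) (z₀ := 0)
    (ρ := 12 * Real.exp (2 * K) * 2 / D + 2) (by
      apply Differentiable.differentiableOn; simp only [hf]; fun_prop)
    (fun ζ _ => hf0 ζ) (fun ζ _ => hfat ζ) 1 (by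
      rw [mem_ball, dist_zero_right, norm_one]
      have : 0 < 12 * Real.exp (2 * K) * 2 / D := by positivity
      linarith)
  simp only [id, sub_zero, norm_one, mul_one] at this
  rw [le_div_iff₀ (by positivity)] at this
  change D * _ ≤ _ at this
  rw [mul_add, mul_div_cancel₀ _ hD.ne'] at this
  linarith

lemma perfect {K c : ℝ} (hK : 0 ≤ K) {S : Set (CSphere → CSphere)} (hS : ∀ h ∈ S, Good K h)
    (hc : 0 < c) (hc1 : c ≤ 1 / 4)
    (heq : ∀ h ∈ S, ∀ x y, dist x y < c → dist (h x) (h y) < 1 / 2)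
    {H : Set (CSphere → CSphere)} (hH : IsSubsemigroupOf H (genSet S)) :
    UnifPerfect (rsJulia H)
      ((2 * (24 * Real.exp (2 * K) * Real.pi / c + 1) + Real.log 2) / (2 * Real.pi)) := by
  obtain ⟨⟨h, hh⟩, hsub, hcomp⟩ := hH
  have hl2 : 0 < Real.log 2 := Real.log_pos (by norm_num)
  have hpi := Real.pi_pos
  constructor
  · obtain ⟨l, h0, hl, rfl⟩ := hsub hh
    exact nontriv hcomp hh (wd_good hK hS l hl h0)
  intro a r R hr hrR hann hin hout
  rw [mul_div_cancel₀ _ (by positivity)]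
  by_contra hcon
  push Not at hcon
  obtain ⟨x, hxJ, hx⟩ := hin
  obtain ⟨y, hyJ, hy⟩ := hout
  rw [mem_ofPred_eq] at hx hy
  have hR2 : R ≤ 2 := hy.trans (dist_le_two _ _)
  have hR : 0 < R := hr.trans hrR
  set ρ := (Real.log (R / 2) - Real.log r) / 2 with hρd
  set m := (Real.log (R / 2) + Real.log r) / 2 with hm
  set s := Real.exp m with hsd
  have hs : 0 < s := Real.exp_pos _
  have hls : Real.log s = m := Real.log_exp _
  have hρ1 : 24 * Real.exp (2 * K) * Real.pi / c + 1 ≤ ρ := by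
    rw [Real.log_div hR.ne' hr.ne'] at hcon
    rw [hρd, Real.log_div hR.ne' (by norm_num)]
    linarith
  have hρc : 24 * Real.exp (2 * K) * Real.pi < c * ρ := by
    have : 24 * Real.exp (2 * K) * Real.pi / c < ρ := by linarith
    rw [div_lt_iff₀ hc] at this
    linarith
  have hE : 1 ≤ Real.exp (2 * K) := Real.one_le_exp (by positivity)
  have hρ0 : 0 < ρ := by
    have : 0 < 24 * Real.exp (2 * K) * Real.pi / c := by positivity
    linarith
  have hR' : Real.log (R / 2) ≤ 0 := Real.log_nonpos (by positivity) (by linarith)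
  have h4s : 4 * s < c := by
    have h1 : s ≤ Real.exp (-ρ) := Real.exp_le_exp.2 (by rw [hm, hρd]; linarith)
    rw [Real.exp_neg] at h1
    have h2 := Real.add_one_le_exp ρ
    have h3 : (Real.exp ρ)⁻¹ ≤ ρ⁻¹ := inv_anti₀ hρ0 (by linarith)
    have h4 : 4 < c * ρ := by nlinarith [Real.pi_gt_three]
    have h5 : 4 * ρ⁻¹ < c := by rw [← div_eq_mul_inv, div_lt_iff₀ hρ0]; exact h4
    linarith
  have hrs : r < s := by
    rw [hsd, ← Real.log_lt_iff_lt_exp hr, hm]; linarith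
  obtain ⟨u, hu0, hu, rfl⟩ := pr_surj a
  have hF : ∀ ζ ∈ ball (Real.log s : ℂ) ρ, pr (Tt u (Complex.exp ζ)) ∈ rsFatou H := by
    intro ζ hζ
    by_contra hn
    rw [mem_ball, dist_eq_norm, hls] at hζ
    have h1 := abs_lt.1 ((Complex.abs_re_le_norm _).trans_lt hζ)
    rw [Complex.sub_re, Complex.ofReal_re] at h1
    have hnorm : ‖Complex.exp ζ‖ = Real.exp ζ.re := Complex.norm_exp ζ
    have ha : r < ‖Complex.exp ζ‖ := by
      rw [hnorm, ← Real.log_lt_iff_lt_exp hr]; linarith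
    have hb : ‖Complex.exp ζ‖ < R / 2 := by
      rw [hnorm, ← Real.lt_log_iff_exp_lt (by positivity)]; linarith
    have h3 := T_lower hu (z := Complex.exp ζ) (by linarith)
    have h4 := T_upper hu (Complex.exp ζ)
    rcases hann _ hn with h5 | h5 <;> linarith
  apply hxJ
  refine Ch (H := H) (r := s - r) ?_ (by linarith) ?_
  · intro g hg
    obtain ⟨l, h0, hl, rfl⟩ := hsub hg
    exact wd_lift hS l hl
  · intro g hg w hw
    obtain ⟨l, h0, hl, rfl⟩ := hsub hg
    have hsm := suffix hK hS hc hc1 heq hcomp hu hs h4s hρc hF [] l (by simp) hl hg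
    have hw1 : dist (pr u) w < s := by
      have := dist_triangle (pr u) x w
      rw [mem_ball, dist_comm] at hw
      linarith
    obtain ⟨z, hz, rfl⟩ := T_surj hu (w := w) (by linarith)
    obtain ⟨z', hz', rfl⟩ := T_surj hu (w := x) (by linarith)
    have e1 := hsm z (by linarith)
    have e2 := hsm z' (by linarith)
    have := dist_triangle_right (wd l (pr (Tt u z))) (wd l (pr (Tt u z'))) (wd l (pr (Tt u s)))
    change dist (wd l _) (wd l _) < _
    linarith

end UPJ
end UPJ

noncomputable section UPJ
open Set Metric Topology Filter MeasureTheory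
open scoped UniformConvergence
namespace UPJ

lemma wg_zero_of_eq {u v : ℂ × ℂ} (hu : u ≠ 0) (hv : v ≠ 0) (h : pr v = pr u) : wg u v = 0 := by
  have h1 := dist_sq_ge hu hv
  rw [h, dist_self] at h1
  by_contra h0
  have h2 := nn_pos hu
  have h3 := nn_pos hv
  have h4 := norm_pos_iff.2 h0
  have : 0 < 2 * ‖wg u v‖ ^ 2 / (nn u * nn v) := by positivity
  norm_num at h1
  linarith

lemma eq_of_wg_zero {u v : ℂ × ℂ} (hu : u ≠ 0) (hv : v ≠ 0) (h : wg u v = 0) : pr v = pr u := by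
  have h1 := dist_sq_le hu hv
  rw [h] at h1
  simp at h1
  exact h1.symm

lemma not_const {K : ℝ} {h : CSphere → CSphere} (hg : Good K h) (b : CSphere) :
    ¬ ∀ x, h x = b := by
  intro hc
  have hn := nontriv (K := K) (H := {h}) (by
    intro a ha b' hb'
    rw [mem_singleton_iff] at *
    subst ha; subst hb'
    funext x; simp [hc]) (mem_singleton h) hg
  obtain ⟨x, hx, _⟩ := hn
  apply hx
  refine ⟨1, one_pos, fun ε hε => ⟨1, one_pos, ?_⟩⟩
  intro g hg w₁ _ w₂ _ _
  rw [mem_singleton_iff] at hg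
  subst hg
  rw [hc, hc, dist_self]; exact hε

lemma local_form {K : ℝ} {h : CSphere → CSphere} (hg : Good K h) {u : ℂ × ℂ} (hu : nn u = 1)
    (hfix : h (pr u) = pr u) (hcr : critPtOn h univ (pr u)) :
    ∃ m : ℕ, 2 ≤ m ∧ ∃ κ : ℂ → ℂ, ∃ η > 0, DifferentiableOn ℂ κ (ball 0 η) ∧
      ∀ z ∈ ball (0:ℂ) η, h (pr (Tt u z)) = pr (Tt u (z ^ m * Complex.exp (κ z))) := by
  have hgood := hg
  obtain ⟨F, d, _, hF, _⟩ := hg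
  have hu0 := ne_of_nn hu
  have hFd : Differentiable ℂ fun ζ => F (Tt u ζ) := hF.diff.comp (Tt_diff u)
  have hne : ∀ ζ, F (Tt u ζ) ≠ 0 := fun ζ => hF.ne _ (Tt_ne hu ζ)
  have hw0 : wg u (F u) = 0 := wg_zero_of_eq hu0 (hF.ne _ hu0) (by rw [← hF.semi _ hu0]; exact hfix)
  have ha0 : al u (F (Tt u 0)) ≠ 0 := by
    intro h0
    rw [Tt_zero] at h0
    have := al_wg u (F u)
    rw [h0, hw0, hu] at this
    have h1 := nn_pos (hF.ne _ hu0)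
    norm_num at this
    linarith
  set A : ℂ → ℂ := fun ζ => al u (F (Tt u ζ)) with hA
  set W : ℂ → ℂ := fun ζ => wg u (F (Tt u ζ)) with hW
  have hAd : Differentiable ℂ A := (al_diff u).comp hFd
  have hWd : Differentiable ℂ W := (wg_diff u).comp hFd
  have hAe : ∀ᶠ z in 𝓝 (0:ℂ), A z ≠ 0 := hAd.continuous.continuousAt.eventually_ne ha0
  set φ : ℂ → ℂ := fun z => W z / A z with hφ
  have hφan : AnalyticAt ℂ φ 0 :=
    (hWd.analyticAt 0).div (hAd.analyticAt 0) ha0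
  have hφ0 : φ 0 = 0 := by simp [hφ, hW, Tt_zero, hw0]
  have hφT : ∀ z, A z ≠ 0 → pr (Tt u (φ z)) = h (pr (Tt u z)) := by
    intro z hz
    rw [hF.semi _ (Tt_ne hu z)]
    exact Tt_dec hu hz
  have hord : analyticOrderAt φ 0 ≠ ⊤ := by
    intro htop
    rw [analyticOrderAt_eq_top] at htop
    have hWz : ∀ᶠ z in 𝓝 (0:ℂ), W z = 0 := by
      filter_upwards [htop, hAe] with z h1 h2
      simp only [hφ] at h1
      rcases div_eq_zero_iff.1 h1 with h | h
      · exact h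
      · exact absurd h h2
    have hWall : ∀ z, W z = 0 := by
      have := AnalyticOnNhd.eq_of_eventuallyEq (f := W) (g := fun _ => 0) (z₀ := 0)
        (fun z _ => hWd.analyticAt z) (fun z _ => analyticAt_const) hWz
      exact fun z => congrFun this z
    have hne' : ∀ v, v ≠ 0 → al u v ≠ 0 → wg u (F v) = 0 := by
      intro v hv ha
      apply wg_zero_of_eq hu0 (hF.ne v hv)
      rw [← hF.semi v hv, ← Tt_dec hu ha, hF.semi _ (Tt_ne hu _)]
      exact eq_of_wg_zero hu0 (hne _) (hWall _)
    refine not_const hgood (pr u) fun x => ?_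
    obtain ⟨v, hv, hv1, rfl⟩ := pr_surj x
    rw [hF.semi v hv]
    apply eq_of_wg_zero hu0 (hF.ne v hv)
    by_cases ha : al u v = 0
    · have hcont : Continuous fun t : ℂ => wg u (F (v + t • u)) :=
        ((wg_diff u).comp hF.diff).continuous.comp (by fun_prop)
      have hext := hcont.ext_on (dense_compl_singleton (0:ℂ)) (continuous_const (y := (0:ℂ))) (by
        intro t ht
        have e : al u (v + t • u) = t := by
          have := nn_c hu
          unfold al at ha ⊢
          simp only [Prod.fst_add, Prod.snd_add, Prod.smul_fst, Prod.smul_snd, smul_eq_mul]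
          linear_combination ha + t * this
        have e0 : al u (v + t • u) ≠ 0 := by rw [e]; exact ht
        apply hne' _ _ e0
        intro h0
        rw [h0] at e0
        simp [al] at e0)
      simpa using congrFun hext 0
    · exact hne' v hv ha
  obtain ⟨k, hk, hk0, hke⟩ := hφan.analyticOrderAt_ne_top.1 hord
  set m := analyticOrderNatAt φ 0 with hm
  have hTc : Continuous fun z => pr (Tt u z) := by
    rw [Metric.continuous_iff]
    intro b ε hε
    refine ⟨ε / 2, by positivity, fun a ha => ?_⟩
    have := T_lip hu a b
    rw [dist_eq_norm] at ha
    linarith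
  have hlim : Tendsto (fun z => ‖φ z‖ / ‖z‖) (𝓝[≠] 0) (𝓝 0) := by
    have hT : Tendsto (fun z => pr (Tt u z)) (𝓝[≠] 0) (𝓝[univ \ {pr u}] (pr u)) := by
      rw [tendsto_nhdsWithin_iff]
      constructor
      · have := hTc.tendsto 0
        rw [Tt_zero] at this
        exact this.mono_left nhdsWithin_le_nhds
      · filter_upwards [self_mem_nhdsWithin] with z hz
        refine ⟨mem_univ _, fun h0 => hz ?_⟩
        have := wg_zero_of_eq hu0 (Tt_ne hu z) h0
        rwa [wg_Tt hu] at this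
    have h1 := hcr.comp hT
    have h2 := h1.const_mul 2
    rw [mul_zero] at h2
    have hφs : ∀ᶠ z in 𝓝 (0:ℂ), ‖φ z‖ < 1 := by
      have := hφan.continuousAt.norm
      rw [ContinuousAt, hφ0, norm_zero] at this
      exact this.eventually (gt_mem_nhds one_pos)
    refine squeeze_zero' (Eventually.of_forall fun z => by positivity) ?_ h2
    filter_upwards [self_mem_nhdsWithin, nhdsWithin_le_nhds hφs, nhdsWithin_le_nhds hAe] with z hz h3 h4
    simp only [Function.comp]
    have hz' : 0 < ‖z‖ := norm_pos_iff.2 hz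
    have h5 := T_lower hu h3.le
    rw [hφT z h4, ← hfix] at h5
    rw [dist_comm] at h5
    have h6 := T_upper hu z
    rw [dist_comm] at h6
    have h7 : 0 < dist (pr (Tt u z)) (pr u) := by
      rw [dist_pos]
      intro h0
      have := wg_zero_of_eq hu0 (Tt_ne hu z) h0
      rw [wg_Tt hu] at this
      exact hz this
    rw [hfix] at h5 ⊢
    rw [div_le_iff₀ hz']
    have e : 2 * (dist (h (pr (Tt u z))) (pr u) / dist (pr (Tt u z)) (pr u)) * ‖z‖ =
      dist (h (pr (Tt u z))) (pr u) * (2 * ‖z‖ / dist (pr (Tt u z)) (pr u)) := by ring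
    rw [e]
    have h8 : 1 ≤ 2 * ‖z‖ / dist (pr (Tt u z)) (pr u) := by rwa [one_le_div h7]
    nlinarith [dist_nonneg (x := h (pr (Tt u z))) (y := pr u)]
  have hm2 : 2 ≤ m := by
    by_contra hlt
    have hm01 : m = 0 ∨ m = 1 := by omega
    rcases hm01 with h0 | h0
    · rw [h0] at hke
      have := hke.self_of_nhds
      simp [hφ0] at this
      exact hk0 this.symm
    · rw [h0] at hke
      have h1 : Tendsto (fun z => ‖k z‖) (𝓝[≠] 0) (𝓝 ‖k 0‖) :=
        (hk.continuousAt.norm).mono_left nhdsWithin_le_nhds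
      have h2 : (fun z => ‖φ z‖ / ‖z‖) =ᶠ[𝓝[≠] 0] fun z => ‖k z‖ := by
        filter_upwards [self_mem_nhdsWithin, nhdsWithin_le_nhds hke] with z hz h3
        have hz' : 0 < ‖z‖ := norm_pos_iff.2 hz
        rw [h3]
        simp
        field_simp
      have := tendsto_nhds_unique (hlim.congr' h2) h1
      exact hk0 (norm_eq_zero.1 this.symm)
  refine ⟨m, hm2, fun z => Complex.log (k z / k 0) + Complex.log (k 0), ?_⟩
  have hsl : ∀ᶠ z in 𝓝 (0:ℂ), k z / k 0 ∈ Complex.slitPlane := by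
    have hc : ContinuousAt (fun z => k z / k 0) 0 := hk.continuousAt.div_const _
    apply hc.preimage_mem_nhds
    apply Complex.isOpen_slitPlane.mem_nhds
    rw [div_self hk0]; exact Complex.one_mem_slitPlane
  obtain ⟨η, hη, hball⟩ := Metric.eventually_nhds_iff_ball.1
    (hsl.and (hk.eventually_analyticAt.and (hke.and hAe)))
  refine ⟨η, hη, ?_, ?_⟩
  · intro z hz
    obtain ⟨h1, h2, -⟩ := hball z hz
    exact (((h2.differentiableAt.div_const _).clog h1).add_const _).differentiableWithinAt
  · intro z hz
    obtain ⟨h1, -, h3, h4⟩ := hball z hz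
    rw [← hφT z h4, h3, Complex.exp_add, Complex.exp_log (Complex.slitPlane_ne_zero h1),
      Complex.exp_log hk0, div_mul_cancel₀ _ hk0]
    simp

lemma log_form {h : CSphere → CSphere} {u : ℂ × ℂ} {m : ℕ} (hm : 2 ≤ m) {κ : ℂ → ℂ} {η : ℝ}
    (hη : 0 < η) (hκ : DifferentiableOn ℂ κ (ball 0 η))
    (heq : ∀ z ∈ ball (0:ℂ) η, h (pr (Tt u z)) = pr (Tt u (z ^ m * Complex.exp (κ z)))) :
    ∃ τ : ℝ, Real.exp (-τ) ≤ 1 / 4 ∧ ∃ f : ℂ → ℂ, DifferentiableOn ℂ f {ζ | ζ.re < -τ} ∧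
      MapsTo f {ζ | ζ.re < -τ} {ζ | ζ.re < -τ} ∧
      (∀ x ∈ {ζ : ℂ | ζ.re < -τ}, ∀ y ∈ {ζ : ℂ | ζ.re < -τ}, 3 / 2 * ‖x - y‖ ≤ ‖f x - f y‖) ∧
      ∀ ζ ∈ {ζ : ℂ | ζ.re < -τ}, h (pr (Tt u (Complex.exp ζ))) = pr (Tt u (Complex.exp (f ζ))) := by
  have hm' : (2:ℝ) ≤ m := by exact_mod_cast hm
  have han : AnalyticAt ℂ κ 0 := hκ.analyticAt (ball_mem_nhds _ hη)
  have e1 : ∀ᶠ z in 𝓝 (0:ℂ), ‖κ z‖ < ‖κ 0‖ + 1 :=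
    han.continuousAt.norm.eventually (gt_mem_nhds (by linarith))
  have e2 : ∀ᶠ z in 𝓝 (0:ℂ), ‖deriv κ z‖ < ‖deriv κ 0‖ + 1 :=
    han.deriv.continuousAt.norm.eventually (gt_mem_nhds (by linarith))
  set M := ‖κ 0‖ + 1
  set B := ‖deriv κ 0‖ + 1 with hB
  have hBp : 0 < B := by positivity
  obtain ⟨η', hη', hball⟩ := Metric.eventually_nhds_iff_ball.1
    ((e1.and e2).and (ball_mem_nhds (0:ℂ) hη))
  set a := min η' (min (1 / (2 * B)) (1 / 4)) with ha
  have hap : 0 < a := by positivity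
  set τ := max M (-Real.log a) with hτ
  have hea : Real.exp (-τ) ≤ a := by
    rw [← Real.le_log_iff_exp_le hap]
    have := le_max_right M (-Real.log a)
    linarith
  have hsm : ∀ ζ ∈ {ζ : ℂ | ζ.re < -τ}, ‖Complex.exp ζ‖ < a := by
    intro ζ hζ
    rw [Complex.norm_exp]
    exact (Real.exp_lt_exp.2 hζ).trans_le hea
  have hmem : ∀ ζ ∈ {ζ : ℂ | ζ.re < -τ}, Complex.exp ζ ∈ ball (0:ℂ) η' := by
    intro ζ hζ
    rw [mem_ball_zero_iff]
    exact (hsm ζ hζ).trans_le (min_le_left _ _)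
  have hder : ∀ ζ ∈ {ζ : ℂ | ζ.re < -τ},
      HasDerivAt (fun ζ => κ (Complex.exp ζ)) (deriv κ (Complex.exp ζ) * Complex.exp ζ) ζ := by
    intro ζ hζ
    have h1 := (hball _ (hmem ζ hζ)).2
    have h2 := (hκ.differentiableAt (isOpen_ball.mem_nhds h1)).hasDerivAt
    exact h2.comp ζ (Complex.hasDerivAt_exp ζ)
  have hconv : Convex ℝ {ζ : ℂ | ζ.re < -τ} := convex_halfSpace_re_lt _
  refine ⟨τ, hea.trans ((min_le_right _ _).trans (min_le_right _ _)),
    fun ζ => m * ζ + κ (Complex.exp ζ), ?_, ?_, ?_, ?_⟩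
  · intro ζ hζ
    exact ((differentiableAt_id.const_mul _).add (hder ζ hζ).differentiableAt).differentiableWithinAt
  · intro ζ hζ
    have h1 := (hball _ (hmem ζ hζ)).1.1
    have h2 := (Complex.abs_re_le_norm (κ (Complex.exp ζ)))
    have h3 := le_abs_self (κ (Complex.exp ζ)).re
    have hζ' : ζ.re < -τ := hζ
    have h4 : M ≤ τ := le_max_left _ _
    have h5 : 0 < M := by positivity
    have : ((m:ℂ) * ζ + κ (Complex.exp ζ)).re = m * ζ.re + (κ (Complex.exp ζ)).re := by
      simp
    change ((m:ℂ) * ζ + κ (Complex.exp ζ)).re < -τ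
    rw [this]
    nlinarith
  · intro x hx y hy
    have hL := hconv.norm_image_sub_le_of_norm_hasDerivWithin_le (C := 1 / 2)
      (fun ζ hζ => (hder ζ hζ).hasDerivWithinAt) (by
        intro ζ hζ
        rw [norm_mul]
        have h1 := (hball _ (hmem ζ hζ)).1.2
        have h2 := (hsm ζ hζ).le.trans ((min_le_right _ _).trans (min_le_left _ _))
        calc ‖deriv κ (Complex.exp ζ)‖ * ‖Complex.exp ζ‖ ≤ B * (1 / (2 * B)) := by gcongr
          _ = 1 / 2 := by field_simp) hy hx
    have e : ((m:ℂ) * x + κ (Complex.exp x)) - (m * y + κ (Complex.exp y)) =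
      m * (x - y) + (κ (Complex.exp x) - κ (Complex.exp y)) := by ring
    rw [e]
    have h1 := norm_sub_le_norm_add (m * (x - y)) (κ (Complex.exp x) - κ (Complex.exp y))
    rw [norm_mul, Complex.norm_natCast] at h1
    nlinarith [norm_nonneg (x - y)]
  · intro ζ hζ
    rw [heq _ (hball _ (hmem ζ hζ)).2, Complex.exp_add, ← Complex.exp_nat_mul]

end UPJ
end UPJ

noncomputable section UPJ
open Set Metric Topology Filter MeasureTheory
open scoped UniformConvergence
namespace UPJ

lemma part2 {K C : ℝ} {H : Set (CSphere → CSphere)} (hcomp : ∀ a ∈ H, ∀ b ∈ H, a ∘ b ∈ H)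
    (hlift : ∀ g ∈ H, Good K g) (hUP : UnifPerfect (rsJulia H) C)
    {z₀ : CSphere} (hz₀ : z₀ ∈ rsJulia H) {h : CSphere → CSphere} (hh : h ∈ H)
    (hfix : h z₀ = z₀) (hcr : critPtOn h univ z₀) : z₀ ∈ interior (rsJulia H) := by
  obtain ⟨u, hu0, hu, rfl⟩ := pr_surj z₀
  obtain ⟨m, hm, κ, η, hη, hκ, heq⟩ := local_form (hlift h hh) hu hfix hcr
  obtain ⟨τ, hτ, f, hfd, hmaps, hexp, hsemi⟩ := log_form hm hη hκ heq
  clear heq hκ hη hm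
  set P : Set ℂ := {ζ : ℂ | ζ.re < -τ} with hP
  have hPo : IsOpen P := isOpen_lt Complex.continuous_re continuous_const
  have hJ : interior (rsJulia H) = (closure (rsFatou H))ᶜ := interior_compl
  by_contra hcon
  rw [hJ, notMem_compl_iff, Metric.mem_closure_iff] at hcon
  set E : ℂ → CSphere := fun ζ => pr (Tt u (Complex.exp ζ)) with hE
  have hEc : Continuous E := by
    have hTc : Continuous fun z => pr (Tt u z) := by
      rw [Metric.continuous_iff]
      intro b ε hε
      refine ⟨ε / 2, by positivity, fun a ha => ?_⟩
      have := T_lip hu a b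
      rw [dist_eq_norm] at ha
      linarith
    exact hTc.comp Complex.continuous_exp
  -- forward invariance
  have hinv : ∀ ζ ∈ P, E ζ ∈ rsFatou H → E (f ζ) ∈ rsFatou H := by
    intro ζ hζ hF
    obtain ⟨r, hr, hfat⟩ := hF
    obtain ⟨δ, hδ, hfat⟩ := hfat (1 / 2) (by norm_num)
    have hnb : ∀ᶠ x in 𝓝 ζ, x ∈ P ∧ dist (E x) (E ζ) < min r δ :=
      (hPo.eventually_mem hζ).and (hEc.continuousAt.eventually (ball_mem_nhds _ (lt_min hr hδ)))
    obtain ⟨e, he, hball⟩ := Metric.nhds_basis_closedBall.eventually_iff.1 hnb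
    have hcb : closedBall ζ e ⊆ P := fun x hx => (hball hx).1
    have himg := DiffContOnCl.ball_subset_image_closedBall (f := f) (z₀ := ζ) (r := e)
      (ε := 3 / 2 * e) (by
        apply DifferentiableOn.diffContOnCl
        rw [closure_ball _ he.ne']
        exact hfd.mono hcb) he (by
        intro x hx
        have := hexp x (hcb (sphere_subset_closedBall hx)) ζ hζ
        rw [mem_sphere, dist_eq_norm] at hx
        rw [hx] at this; exact this) (by
        have : ∃ᶠ x in 𝓝[≠] ζ, f x ≠ f ζ := by
          apply Eventually.frequently
          filter_upwards [self_mem_nhdsWithin, nhdsWithin_le_nhds (hPo.mem_nhds hζ)] with x hx hxP h0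
          have := hexp x hxP ζ hζ
          rw [h0, sub_self, norm_zero] at this
          have h3 : 0 < ‖x - ζ‖ := norm_pos_iff.2 (sub_ne_zero.2 hx)
          linarith
        exact this.filter_mono nhdsWithin_le_nhds)
    have hopen : Complex.exp '' ball (f ζ) (3 / 2 * e / 2) ∈ 𝓝 (Complex.exp (f ζ)) := by
      have := (Complex.hasStrictDerivAt_exp (f ζ)).map_nhds_eq (Complex.exp_ne_zero _)
      rw [← this]
      exact image_mem_map (ball_mem_nhds _ (by positivity))
    obtain ⟨t, ht, hts⟩ := Metric.mem_nhds_iff.1 hopen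
    have hw4 : ‖Complex.exp (f ζ)‖ ≤ 1 / 4 := by
      rw [Complex.norm_exp]
      have : (f ζ).re < -τ := hmaps hζ
      exact (Real.exp_le_exp.2 this.le).trans hτ
    refine Ch (r := min (t / 2) (1 / 4))
      (fun g hg => by obtain ⟨F, d, _, hF, _⟩ := hlift g hg; exact ⟨F, d, hF⟩) (by positivity) ?_
    intro g hg x hx
    rw [mem_ball, lt_min_iff] at hx
    have hx1 : dist (pr u) x < 1 := by
      have h1 := T_upper hu (Complex.exp (f ζ))
      have h2 := dist_triangle_right (pr u) x (E (f ζ))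
      have h3 : dist (pr u) (E (f ζ)) ≤ 2 * ‖Complex.exp (f ζ)‖ := h1
      linarith
    obtain ⟨z, hz, rfl⟩ := T_surj hu hx1
    have hzz := T_colip hu (z := z) (z' := Complex.exp (f ζ)) (by linarith) (by linarith)
    have hzm : z ∈ ball (Complex.exp (f ζ)) t := by
      rw [mem_ball, dist_eq_norm]
      have : dist (pr (Tt u z)) (pr (Tt u (Complex.exp (f ζ)))) < t / 2 := hx.1
      linarith
    obtain ⟨ω, hω, rfl⟩ := hts hzm
    obtain ⟨y, hy, rfl⟩ := himg hω
    have hyP := hball hy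
    rw [← hsemi y hyP.1]
    simp only [hE]
    rw [← hsemi ζ hζ]
    exact hfat (g ∘ h) (hcomp g hg h hh) _ (hyP.2.trans_le (min_le_left _ _)) _ (mem_ball_self hr)
      (hyP.2.trans_le (min_le_right _ _))
  -- iterates
  have hitm : ∀ n, MapsTo f^[n] P P := fun n => hmaps.iterate n
  have hitF : ∀ n, ∀ ζ ∈ P, E ζ ∈ rsFatou H → E (f^[n] ζ) ∈ rsFatou H := by
    intro n
    induction n with
    | zero => intro ζ _ h; exact h
    | succ n ih =>
      intro ζ hζ h
      rw [Function.iterate_succ_apply']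
      exact hinv _ (hitm n hζ) (ih ζ hζ h)
  have hitd : ∀ n, DifferentiableOn ℂ f^[n] P := fun n => hfd.iterate hmaps n
  have hite : ∀ n : ℕ, ∀ x ∈ P, ∀ y ∈ P, (3 / 2 : ℝ) ^ n * ‖x - y‖ ≤ ‖f^[n] x - f^[n] y‖ := by
    intro n
    induction n with
    | zero => intro x _ y _; simp
    | succ n ih =>
      intro x hx y hy
      rw [Function.iterate_succ_apply', Function.iterate_succ_apply']
      have h1 := hexp _ (hitm n hx) _ (hitm n hy)
      have h2 := ih x hx y hy
      rw [pow_succ]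
      linarith
  -- base point
  obtain ⟨w, hwF, hw⟩ := hcon (Real.exp (-τ)) (Real.exp_pos _)
  obtain ⟨z, hz, rfl⟩ := T_surj hu (w := w) (by linarith)
  have hz0 : z ≠ 0 := by
    rintro rfl
    rw [Tt_zero] at hwF
    exact hz₀ hwF
  set ζ := Complex.log z with hζd
  have hEζ : E ζ = pr (Tt u z) := by simp only [hE, hζd]; rw [Complex.exp_log hz0]
  have hζ : ζ ∈ P := by
    change (Complex.log z).re < -τ
    rw [Complex.log_re, Real.log_lt_iff_lt_exp (norm_pos_iff.2 hz0)]
    linarith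
  have hnb : ∀ᶠ x in 𝓝 ζ, x ∈ P ∧ E x ∈ rsFatou H :=
    (hPo.eventually_mem hζ).and (hEc.continuousAt.eventually ((fatou_open H).mem_nhds (hEζ ▸ hwF)))
  obtain ⟨e, he, hball⟩ := Metric.nhds_basis_closedBall.eventually_iff.1 hnb
  have hcb : closedBall ζ e ⊆ P := fun x hx => (hball hx).1
  -- other Julia point
  obtain ⟨y, hyJ, hyne⟩ := hUP.1.exists_ne (pr u)
  have hD : 0 < dist (pr u) y := dist_pos.2 hyne.symm
  set D := dist (pr u) y
  set L := max (2 * Real.pi) (max (2 * Real.pi * C + Real.log 2) (-2 * Real.log D)) with hL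
  have hl2 : 0 < Real.log 2 := Real.log_pos (by norm_num)
  have htend : Tendsto (fun n : ℕ => (3 / 2 : ℝ) ^ n * e / 2) atTop atTop :=
    ((tendsto_pow_atTop_atTop_of_one_lt (by norm_num)).atTop_mul_const he).atTop_div_const (by norm_num)
  obtain ⟨n, hn⟩ := (htend.eventually_gt_atTop L).exists
  set W := (3 / 2 : ℝ) ^ n * e / 2 with hW
  have hW1 : 2 * Real.pi < W := (le_max_left _ _).trans_lt hn
  have hW2 : 2 * Real.pi * C + Real.log 2 < W :=
    ((le_max_left _ _).trans (le_max_right _ _)).trans_lt hn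
  have hW3 : -2 * Real.log D < W := ((le_max_right _ _).trans (le_max_right _ _)).trans_lt hn
  have hpi := Real.pi_gt_three
  set ω := f^[n] ζ with hω
  have hbig : ∀ x ∈ ball ω W, x ∈ P ∧ E x ∈ rsFatou H := by
    intro x hx
    have himg := DiffContOnCl.ball_subset_image_closedBall (f := f^[n]) (z₀ := ζ) (r := e)
      (ε := (3 / 2 : ℝ) ^ n * e) (by
        apply DifferentiableOn.diffContOnCl
        rw [closure_ball _ he.ne']
        exact (hitd n).mono hcb) he (by
        intro x hx
        have := hite n x (hcb (sphere_subset_closedBall hx)) ζ hζ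
        rw [mem_sphere, dist_eq_norm] at hx
        rw [hx] at this; exact this) (by
        have : ∃ᶠ x in 𝓝[≠] ζ, f^[n] x ≠ f^[n] ζ := by
          apply Eventually.frequently
          filter_upwards [self_mem_nhdsWithin, nhdsWithin_le_nhds (hPo.mem_nhds hζ)] with x hx hxP h0
          have := hite n x hxP ζ hζ
          rw [h0, sub_self, norm_zero] at this
          have h3 : 0 < ‖x - ζ‖ := norm_pos_iff.2 (sub_ne_zero.2 hx)
          have : 0 < (3 / 2 : ℝ) ^ n * ‖x - ζ‖ := by positivity
          linarith
        exact this.filter_mono nhdsWithin_le_nhds)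
    obtain ⟨y, hy, rfl⟩ := himg hx
    have := hball hy
    exact ⟨hitm n this.1, hitF n y this.1 this.2⟩
  have hτ0 : 0 < τ := by
    by_contra hneg
    have : 1 ≤ Real.exp (-τ) := Real.one_le_exp (by linarith)
    linarith
  have hωW : ω.re + W ≤ 0 := by
    by_contra hpos
    push Not at hpos
    have hωP : ω.re < -τ := hitm n hζ
    have := (hbig (ω + ((-ω.re : ℝ) : ℂ)) (by
      rw [mem_ball, dist_eq_norm, add_sub_cancel_left, Complex.norm_real, Real.norm_eq_abs,
        abs_of_pos (by linarith)]
      linarith)).1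
    have h2 : (ω + ((-ω.re : ℝ) : ℂ)).re < -τ := this
    rw [Complex.add_re, Complex.ofReal_re] at h2
    linarith
  have := hUP.2 (pr u) (2 * Real.exp (ω.re - W / 2)) (Real.exp (ω.re + W / 2)) (by positivity) (by
      have : (2:ℝ) = Real.exp (Real.log 2) := (Real.exp_log (by norm_num)).symm
      rw [this, ← Real.exp_add]
      apply Real.exp_lt_exp.2
      have : Real.log 2 < 1 := by linarith [Real.log_two_lt_d9]
      rw [Real.exp_log (by norm_num)]
      linarith) (by
      intro p hp
      by_contra hpn
      push Not at hpn
      have hR1 : Real.exp (ω.re + W / 2) ≤ 1 := by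
        rw [← Real.exp_zero]; apply Real.exp_le_exp.2; linarith
      obtain ⟨x, hx, rfl⟩ := T_surj hu (w := p) (by linarith)
      have hx2 := T_upper hu x
      have hxl : Real.exp (ω.re - W / 2) < ‖x‖ := by linarith
      have hxu : ‖x‖ < Real.exp (ω.re + W / 2) := by linarith
      have hxp : 0 < ‖x‖ := (Real.exp_pos _).trans hxl
      rw [← Real.lt_log_iff_exp_lt hxp] at hxl
      rw [← Real.log_lt_iff_lt_exp hxp] at hxu
      have hx0 := norm_pos_iff.1 hxp
      set k : ℤ := round ((ω.im - x.arg) / (2 * Real.pi)) with hk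
      set ξ : ℂ := Complex.log x + k * (2 * Real.pi * Complex.I) with hξ
      have hξe : Complex.exp ξ = x := by
        rw [hξ, Complex.exp_add, Complex.exp_log hx0, Complex.exp_int_mul_two_pi_mul_I, mul_one]
      have hre : ξ.re = Real.log ‖x‖ := by simp [hξ, Complex.log_re]
      have him : ξ.im = x.arg + k * (2 * Real.pi) := by simp [hξ, Complex.log_im]
      have hr := abs_sub_round ((ω.im - x.arg) / (2 * Real.pi))
      rw [← hk, abs_le] at hr
      have e0 : (ω.im - x.arg) / (2 * Real.pi) * (2 * Real.pi) = ω.im - x.arg := by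
        field_simp
      have him' : |ξ.im - ω.im| ≤ Real.pi := by
        rw [him, abs_le]
        constructor <;> nlinarith [hr.1, hr.2]
      have hre' : |ξ.re - ω.re| < W / 2 := by
        rw [hre, abs_lt]; constructor <;> linarith
      have hξm : ξ ∈ ball ω W := by
        rw [mem_ball, dist_eq_norm]
        have := Complex.norm_le_abs_re_add_abs_im (ξ - ω)
        rw [Complex.sub_re, Complex.sub_im] at this
        linarith
      have := (hbig ξ hξm).2
      simp only [hE] at this
      rw [hξe] at this
      exact hp this) ⟨pr u, hz₀, by
        rw [mem_ofPred_eq, dist_self]; positivity⟩ ⟨y, hyJ, by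
        rw [mem_ofPred_eq, ← Real.le_log_iff_exp_le hD]
        linarith⟩
  have e2 : Real.exp (ω.re + W / 2) / (2 * Real.exp (ω.re - W / 2)) = Real.exp W / 2 := by
    rw [show ω.re + W / 2 = (ω.re - W / 2) + W by ring, Real.exp_add]
    field_simp
  rw [e2, Real.log_div (Real.exp_pos _).ne' (by norm_num), Real.log_exp] at this
  linarith

theorem main (Λ : Set (CSphere →ᵤ CSphere)) (hcpt : IsCompact Λ)
    (hdeg : ∀ φ ∈ Λ, CSphere.IsRatMapDegGeTwo (UniformFun.toFun φ)) :
    ∃ C > (0:ℝ),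
      (∀ H : Set (CSphere → CSphere),
        IsSubsemigroupOf H (genSet (UniformFun.toFun '' Λ)) →
        UnifPerfect (rsJulia H) C) ∧
      (∀ H : Set (CSphere → CSphere),
        IsSubsemigroupOf H (genSet (UniformFun.toFun '' Λ)) →
        ∀ z₀ ∈ rsJulia H,
          (∃ hm ∈ H, hm z₀ = z₀ ∧ critPtOn hm Set.univ z₀) →
          z₀ ∈ interior (rsJulia H)) := by
  have hl : ∀ h ∈ UniformFun.toFun '' Λ, ∃ F d, 2 ≤ d ∧ IsLift h F d := by
    rintro _ ⟨φ, hφ, rfl⟩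
    obtain ⟨n, hn, hd⟩ := hdeg φ hφ
    obtain ⟨F, hF⟩ := exists_lift hn hd
    exact ⟨F, n, hn, hF⟩
  have hc : ∀ φ ∈ Λ, Continuous (UniformFun.toFun φ) := by
    intro φ hφ
    obtain ⟨F, d, _, hF⟩ := hl _ ⟨φ, hφ, rfl⟩
    exact hF.continuous
  obtain ⟨δ, hδ, heq⟩ := equi Λ hcpt hc (ε := 1 / 2) (by norm_num)
  obtain ⟨K, hK, hgood⟩ := uniform_good _ hl hδ heq
  set c := min δ (1 / 4)
  have hcp : 0 < c := lt_min hδ (by norm_num)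
  have hl2 : 0 < Real.log 2 := Real.log_pos (by norm_num)
  have hpi := Real.pi_pos
  have hperf := fun (H : Set (CSphere → CSphere)) (hH : IsSubsemigroupOf H _) =>
    perfect hK hgood hcp (min_le_right _ _)
      (fun h hh x y hxy => heq h hh x y (hxy.trans_le (min_le_left _ _))) hH
  refine ⟨_, ?_, hperf, ?_⟩
  · positivity
  · intro H hH z₀ hz₀ ⟨h, hh, hfix, hcr⟩
    refine part2 (K := K) hH.2.2 (fun g hg => ?_) (hperf H hH) hz₀ hh hfix hcr
    obtain ⟨l, h0, hl, rfl⟩ := hH.2.1 hg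
    exact wd_good hK hgood l hl h0

end UPJ
end UPJ

/-- **Theorem (Uniform perfectness for rational semigroups, Sumi, Thm 1.25)**.
Let `Λ` be a compact family (for the topology of uniform convergence on `ℂ̂`)
of rational maps of degree at least two, and let `G` be the rational semigroup
generated by `Λ`.  Then there is a constant `C > 0` such that the Julia set of
every subsemigroup `H` of `G` is `C`-uniformly perfect.  Moreover, for any
subsemigroup `H` of `G`, if `z₀ ∈ J(H)` is a superattracting fixed point of
some `h ∈ H` (i.e. `h(z₀) = z₀`, `h′(z₀) = 0`), then `z₀` lies in the interior
of `J(H)`. -/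
theorem uniformly_perfect_julia_sets_of_subsemigroups
    (Λ : Set (CSphere →ᵤ CSphere)) (hcpt : IsCompact Λ)
    (hdeg : ∀ φ ∈ Λ, CSphere.IsRatMapDegGeTwo (UniformFun.toFun φ)) :
    ∃ C > (0:ℝ),
      (∀ H : Set (CSphere → CSphere),
        IsSubsemigroupOf H (genSet (UniformFun.toFun '' Λ)) →
        UnifPerfect (rsJulia H) C) ∧
      (∀ H : Set (CSphere → CSphere),
        IsSubsemigroupOf H (genSet (UniformFun.toFun '' Λ)) →
        ∀ z₀ ∈ rsJulia H,
          (∃ hm ∈ H, hm z₀ = z₀ ∧ critPtOn hm Set.univ z₀) →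
          z₀ ∈ interior (rsJulia H)) := by
  exact UPJ.main Λ hcpt hdeg
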